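/- arXiv:1101.3014 — 2 statements merged into one kernel-verified Lean document; each statement's English description precedes it below -/
import Mathlib

section
/- Let (M,ρ) be a finite pseudometric space. Then mf₋(M) = mf(M), i.e. the infimum of total weight over all generalized fillings of (M,ρ) whose type is a tree in which every vertex of degree 1 is boundary equals the infimum of total weight over all fillings of (M,ρ) (with nonnegative weight functions). Equivalently, there exists a filling with nonnegative weight function whose total weight equals mf₋(M). -/
open scoped BigOperators

namespace MinFill

variable {V : Type*}

/-- The total weight of a (generalized) weighted graph: the sum of the weights
of its edges. -/
noncomputable def graphWeight (G : SimpleGraph V) (w : Sym2 V → ℝ) : ℝ :=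
  ∑ᶠ e ∈ G.edgeSet, w e

/-- The weight of a walk: the sum of the weights of its edges. -/
def walkWeight {G : SimpleGraph V} (w : Sym2 V → ℝ) {u v : V} (p : G.Walk u v) : ℝ :=
  (p.edges.map w).sum

/-- `dw G w u v` is the minimum over simple paths in `G` from `u` to `v` of the
sum of the weights of their edges. -/
noncomputable def dw (G : SimpleGraph V) (w : Sym2 V → ℝ) (u v : V) : ℝ :=
  sInf {r : ℝ | ∃ p : G.Walk u v, p.IsPath ∧ walkWeight w p = r}

/-- The degree of a vertex: the number of edges incident to it. -/
noncomputable def deg (G : SimpleGraph V) (v : V) : ℕ :=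
  (G.neighborSet v).ncard

/-- `ρ` is a pseudometric on the subset `M`: symmetric, nonnegative, vanishing
on the diagonal and satisfying the triangle inequality. -/
def IsPseudometricOn (M : Set V) (ρ : V → V → ℝ) : Prop :=
  (∀ p ∈ M, ∀ q ∈ M, ρ p q = ρ q p) ∧
  (∀ p ∈ M, ∀ q ∈ M, 0 ≤ ρ p q) ∧
  (∀ p ∈ M, ρ p p = 0) ∧
  (∀ p ∈ M, ∀ q ∈ M, ∀ r ∈ M, ρ p r ≤ ρ p q + ρ q r)

/-- `(G, w)` is a generalized filling of `(M, ρ)` (with `M ⊆ V`): `G` is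
connected (and joins `M`), and for all boundary points `p, q ∈ M` every simple
path in `G` from `p` to `q` has weight at least `ρ p q` (equivalently
`ρ p q ≤ d_w(p, q)`). -/
def IsGenFilling (G : SimpleGraph V) (w : Sym2 V → ℝ) (M : Set V) (ρ : V → V → ℝ) : Prop :=
  G.Connected ∧ ∀ p ∈ M, ∀ q ∈ M, ∀ γ : G.Walk p q, γ.IsPath → ρ p q ≤ walkWeight w γ


/-- `ρ` is a pseudometric on the finite set `M`. -/
def IsPseudometric {M : Type*} (ρ : M → M → ℝ) : Prop :=
  (∀ p q, ρ p q = ρ q p) ∧ (∀ p q, 0 ≤ ρ p q) ∧ (∀ p, ρ p p = 0) ∧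
    (∀ p q r, ρ p r ≤ ρ p q + ρ q r)

/-- `(G, w)` is a generalized filling of `(M, ρ)`, where the boundary `M` is
embedded into the vertex set via `ι`. -/
def IsGenFillingE {M V : Type*} (G : SimpleGraph V) (ι : M ↪ V) (w : Sym2 V → ℝ)
    (ρ : M → M → ℝ) : Prop :=
  G.Connected ∧ ∀ p q : M, ∀ γ : G.Walk (ι p) (ι q), γ.IsPath → ρ p q ≤ walkWeight w γ

/-- The type `G` is a tree in which every vertex of degree 1 is boundary. -/
def GoodType {M V : Type*} (G : SimpleGraph V) (ι : M ↪ V) : Prop :=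
  G.IsTree ∧ ∀ v : V, deg G v = 1 → v ∈ Set.range ι

/-- The generalized minimal filling weight `mf₋(M)`: the infimum of total
weight over all generalized fillings of `(M, ρ)` whose type is a tree in which
every vertex of degree 1 is boundary. -/
noncomputable def mfNeg (M : Type) [Fintype M] (ρ : M → M → ℝ) : ℝ :=
  sInf {r : ℝ | ∃ (V : Type) (_ : Fintype V) (G : SimpleGraph V) (ι : M ↪ V)
    (w : Sym2 V → ℝ),
      IsGenFillingE G ι w ρ ∧ GoodType G ι ∧ r = graphWeight G w}

/-- The minimal filling weight `mf(M)`: the infimum of total weight over all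
fillings of `(M, ρ)` (with nonnegative weight functions). -/
noncomputable def mf (M : Type) [Fintype M] (ρ : M → M → ℝ) : ℝ :=
  sInf {r : ℝ | ∃ (V : Type) (_ : Fintype V) (G : SimpleGraph V) (ι : M ↪ V)
    (w : Sym2 V → ℝ),
      IsGenFillingE G ι w ρ ∧ (∀ e ∈ G.edgeSet, 0 ≤ w e) ∧ r = graphWeight G w}

section Splits

variable {M : Type*} [Fintype M] [DecidableEq M]

/-- Two subsets are compatible if the splits of the ground set they define are
realised by two edges of a common tree. -/
def Compat (A B : Finset M) : Prop :=
  (∀ x ∈ A, x ∈ B) ∨ (∀ x ∈ B, x ∈ A) ∨ (∀ x ∈ A, x ∉ B) ∨ ∀ x, x ∈ A ∨ x ∈ B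

/-- The split pseudometric of `A`. -/
def sep (A : Finset M) (p q : M) : ℝ := if (p ∈ A ↔ q ∈ A) then 0 else 1

/-- The side of the split defined by `A` which avoids `r`. -/
def unrooted (r : M) (A : Finset M) : Finset M := if r ∈ A then Aᶜ else A

/-- A pairwise compatible family of nonempty sets avoiding `r`. -/
structure IsSplitFamily (r : M) (F : Set (Finset M)) : Prop where
  compat : ∀ A ∈ F, ∀ B ∈ F, Compat A B
  root_notMem : ∀ A ∈ F, r ∉ A
  nonempty : ∀ A ∈ F, A.Nonempty

/-- The distance defined by a weighted family of splits. -/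
def splitDist (w : Finset M → ℝ) (p q : M) : ℝ := ∑ T, w T * sep T p q

/-- The total weight of a weighted family of splits. -/
def splitWeight (w : Finset M → ℝ) : ℝ := ∑ T, w T

lemma Compat.symm {A B : Finset M} (h : Compat A B) : Compat B A := by
  unfold Compat at *; grind

lemma compat_self (A : Finset M) : Compat A A := Or.inl fun _ h => h

lemma compat_compl_left {A B : Finset M} : Compat Aᶜ B ↔ Compat A B := by
  unfold Compat
  simp only [Finset.mem_compl]
  grind

lemma compat_unrooted_left {r : M} {A B : Finset M} :
    Compat (unrooted r A) B ↔ Compat A B := by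
  unfold unrooted; split_ifs
  · exact compat_compl_left
  · rfl

lemma compat_unrooted_right {r : M} {A B : Finset M} :
    Compat A (unrooted r B) ↔ Compat A B :=
  ⟨fun h => (compat_unrooted_left.1 h.symm).symm, fun h => (compat_unrooted_left.2 h.symm).symm⟩

lemma root_notMem_unrooted (r : M) (A : Finset M) : r ∉ unrooted r A := by
  unfold unrooted; split_ifs with h <;> simp [h]

lemma unrooted_nonempty {r : M} {A : Finset M} (h : A.Nonempty) (h' : Aᶜ.Nonempty) :
    (unrooted r A).Nonempty := by
  unfold unrooted; split_ifs <;> assumption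

lemma sep_unrooted (r : M) (A : Finset M) : sep (unrooted r A) = sep A := by
  funext p q
  unfold unrooted sep
  split_ifs <;> simp_all; grind

/-- A set compatible with a compatible family can be cut into two pieces compatible
with the family. -/
lemma exists_compat_partition {F : Set (Finset M)} (hF : ∀ A ∈ F, ∀ B ∈ F, Compat A B)
    {S : Finset M} (hS : ∀ T ∈ F, Compat T S) (hcard : S.Nontrivial) :
    ∃ A B : Finset M, A.Nonempty ∧ B.Nonempty ∧ Disjoint A B ∧ A ∪ B = S ∧
      (∀ T ∈ F, Compat T A) ∧ ∀ T ∈ F, Compat T B := by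
  classical
  let cand : Finset (Finset M) := Finset.univ.filter fun A =>
    A ⊂ S ∧ A.Nonempty ∧ (A ∈ F ∨ Aᶜ ∈ F ∨ ∃ a, A = {a})
  have hne : cand.Nonempty := by
    obtain ⟨a, ha, b, hb, hab⟩ := hcard
    refine ⟨{a}, ?_⟩
    simp only [cand, Finset.mem_filter, Finset.mem_univ, true_and]
    refine ⟨?_, by simp, Or.inr (Or.inr ⟨a, rfl⟩)⟩
    rw [Finset.ssubset_iff_of_subset (by simpa using ha)]
    exact ⟨b, hb, by simpa using hab.symm⟩
  obtain ⟨A, hA, hmax⟩ := cand.exists_max_image Finset.card hne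
  simp only [cand, Finset.mem_filter, Finset.mem_univ, true_and] at hA hmax
  obtain ⟨hAS, hAne, hAF⟩ := hA
  have hmax' : ∀ T, T ⊂ S → (T ∈ F ∨ Tᶜ ∈ F) → A ⊆ T → T = A := by
    intro T hTS hTF hAT
    refine (Finset.eq_of_subset_of_card_le hAT (hmax T ⟨hTS, hAne.mono hAT, ?_⟩)).symm
    tauto
  have hTA : ∀ T ∈ F, Compat T A := by
    rintro T hT
    rcases hAF with h | h | ⟨a, rfl⟩
    · exact hF T hT A h
    · exact (compat_compl_left.1 (hF _ h T hT)).symm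
    · unfold Compat; by_cases h : a ∈ T <;> simp [h]
  -- a member of the family, or its complement, which lies inside `S`
  have key : ∀ T, (T ∈ F ∨ Tᶜ ∈ F) → Compat T A → T ⊆ S → Compat T (S \ A) := by
    intro T hT hTA hTS
    rcases hTA with h | h | h | h
    · right; right; left; grind
    · rcases eq_or_ne T S with rfl | hne
      · right; left; grind
      · have := hmax' T (hTS.ssubset_of_ne hne) hT h
        subst this
        right; right; left; grind
    · left; grind
    · right; left; grind
  refine ⟨A, S \ A, hAne, ?_, Finset.disjoint_sdiff, Finset.union_sdiff_of_subset hAS.subset,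
    hTA, ?_⟩
  · exact Finset.sdiff_nonempty.2 hAS.not_subset
  · intro T hT
    rcases hS T hT with h | h | h | h
    · exact key T (Or.inl hT) (hTA T hT) h
    · right; left; grind
    · right; right; left; grind
    · refine compat_compl_left.1 (key Tᶜ (Or.inr (by simpa using hT))
        (compat_compl_left.2 (hTA T hT)) ?_)
      intro x hx
      exact (h x).resolve_left (Finset.mem_compl.1 hx)

/-- If `T` is compatible with the four pieces of a partition and with the union of the first
two, but is not that split itself, then it is compatible with the union of the first and third. -/
lemma Compat.union_of_partition {A B C D S T : Finset M} (hA : Compat T A) (hB : Compat T B)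
    (hC : Compat T C) (hD : Compat T D) (hS : Compat T S)
    (hAB : Disjoint A B) (hCD : Disjoint C D) (hS₁ : A ∪ B = S) (hS₂ : C ∪ D = Sᶜ)
    (hne : T ≠ S) (hne' : T ≠ Sᶜ) : Compat T (A ∪ C) := by
  have m₁ : ∀ x, x ∈ S ↔ x ∈ A ∨ x ∈ B := fun x => by simp [← hS₁]
  have m₂ : ∀ x, x ∉ S ↔ x ∈ C ∨ x ∈ D := fun x => by
    rw [← Finset.mem_compl, ← hS₂, Finset.mem_union]
  have m₃ : ∀ x, x ∈ A → x ∉ B := Finset.disjoint_left.1 hAB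
  have m₄ : ∀ x, x ∈ C → x ∉ D := Finset.disjoint_left.1 hCD
  have n₁ : ¬ ∀ x, x ∈ T ↔ x ∈ S := fun h => hne (Finset.ext h)
  have n₂ : ¬ ∀ x, x ∈ T ↔ x ∉ S := fun h => hne' (Finset.ext fun x => by simp [h])
  clear hAB hCD hS₁ hS₂ hne hne'
  unfold Compat at *
  simp only [Finset.mem_union]
  rcases hA with h | h | h | h
  · left; grind
  · rcases hB with h' | h' | h' | h' <;> grind
  · rcases hB with h' | h' | h' | h' <;> grind
  · right; right; right; grind

end Splits

section SplitOps

variable {M : Type*} [Fintype M] [DecidableEq M]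

lemma splitDist_add (v w : Finset M → ℝ) (p q : M) :
    splitDist (v + w) p q = splitDist v p q + splitDist w p q := by
  simp [splitDist, add_mul, Finset.sum_add_distrib]

lemma splitDist_single (A : Finset M) (c : ℝ) (p q : M) :
    splitDist (Pi.single A c) p q = c * sep A p q := by
  simp [splitDist, Pi.single_apply]

lemma splitWeight_add (v w : Finset M → ℝ) :
    splitWeight (v + w) = splitWeight v + splitWeight w := by
  simp [splitWeight, Finset.sum_add_distrib]

lemma splitWeight_single (A : Finset M) (c : ℝ) : splitWeight (Pi.single A c) = c := by
  simp [splitWeight, Pi.single_apply]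

lemma IsSplitFamily.mono {r : M} {F F' : Set (Finset M)} (h : IsSplitFamily r F)
    (hF : F' ⊆ F) : IsSplitFamily r F' :=
  ⟨fun A hA B hB => h.compat A (hF hA) B (hF hB), fun A hA => h.root_notMem A (hF hA),
    fun A hA => h.nonempty A (hF hA)⟩

lemma IsSplitFamily.union_unrooted {r : M} {F G : Set (Finset M)} (hF : IsSplitFamily r F)
    (hG : ∀ X ∈ G, ∀ Y ∈ G, Compat X Y) (hFG : ∀ T ∈ F, ∀ X ∈ G, Compat T X)
    (hne : ∀ X ∈ G, X.Nonempty ∧ Xᶜ.Nonempty) :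
    IsSplitFamily r (F ∪ unrooted r '' G) := by
  refine ⟨?_, ?_, ?_⟩
  · rintro A (hA | ⟨X, hX, rfl⟩) B (hB | ⟨Y, hY, rfl⟩)
    · exact hF.compat A hA B hB
    · exact compat_unrooted_right.2 (hFG A hA Y hY)
    · exact compat_unrooted_left.2 (hFG B hB X hX).symm
    · exact compat_unrooted_left.2 (compat_unrooted_right.2 (hG X hX Y hY))
  · rintro A (hA | ⟨X, hX, rfl⟩)
    · exact hF.root_notMem A hA
    · exact root_notMem_unrooted r X
  · rintro A (hA | ⟨X, hX, rfl⟩)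
    · exact hF.nonempty A hA
    · exact unrooted_nonempty (hne X hX).1 (hne X hX).2

/-- The four cells of a partition, membershipwise. -/
lemma mem_cells {A B C D S : Finset M} (m₁ : ∀ x, x ∈ S ↔ x ∈ A ∨ x ∈ B)
    (m₂ : ∀ x, x ∉ S ↔ x ∈ C ∨ x ∈ D) (m₃ : ∀ x, x ∈ A → x ∉ B) (m₄ : ∀ x, x ∈ C → x ∉ D)
    (x : M) : (x ∈ A ∧ x ∉ B ∧ x ∉ C ∧ x ∉ D ∧ x ∈ S) ∨
      (x ∉ A ∧ x ∈ B ∧ x ∉ C ∧ x ∉ D ∧ x ∈ S) ∨ (x ∉ A ∧ x ∉ B ∧ x ∈ C ∧ x ∉ D ∧ x ∉ S) ∨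
      (x ∉ A ∧ x ∉ B ∧ x ∉ C ∧ x ∈ D ∧ x ∉ S) := by
  by_cases h : x ∈ S
  · have hC : x ∉ C := fun hc => (m₂ x).2 (.inl hc) h
    have hD : x ∉ D := fun hd => (m₂ x).2 (.inr hd) h
    rcases (m₁ x).1 h with hA | hB
    · exact .inl ⟨hA, m₃ x hA, hC, hD, h⟩
    · exact .inr (.inl ⟨fun hA => m₃ x hA hB, hB, hC, hD, h⟩)
  · have hA : x ∉ A := fun ha => h ((m₁ x).2 (.inl ha))
    have hB : x ∉ B := fun hb => h ((m₁ x).2 (.inr hb))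
    rcases (m₂ x).1 h with hC | hD
    · exact .inr (.inr (.inl ⟨hA, hB, hC, m₄ x hC, h⟩))
    · exact .inr (.inr (.inr ⟨hA, hB, fun hC => m₄ x hC hD, hD, h⟩))

lemma sep_cells_nonneg {A B C D S : Finset M} {p q : M}
    (hp : (p ∈ A ∧ p ∉ B ∧ p ∉ C ∧ p ∉ D ∧ p ∈ S) ∨
      (p ∉ A ∧ p ∈ B ∧ p ∉ C ∧ p ∉ D ∧ p ∈ S) ∨ (p ∉ A ∧ p ∉ B ∧ p ∈ C ∧ p ∉ D ∧ p ∉ S) ∨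
      (p ∉ A ∧ p ∉ B ∧ p ∉ C ∧ p ∈ D ∧ p ∉ S))
    (hq : (q ∈ A ∧ q ∉ B ∧ q ∉ C ∧ q ∉ D ∧ q ∈ S) ∨
      (q ∉ A ∧ q ∈ B ∧ q ∉ C ∧ q ∉ D ∧ q ∈ S) ∨ (q ∉ A ∧ q ∉ B ∧ q ∈ C ∧ q ∉ D ∧ q ∉ S) ∨
      (q ∉ A ∧ q ∉ B ∧ q ∉ C ∧ q ∈ D ∧ q ∉ S)) :
    0 ≤ sep S p q - (sep A p q + sep B p q + sep C p q + sep D p q) / 2 +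
      sep (A ∪ C) p q := by
  unfold sep
  simp only [Finset.mem_union]
  rcases hp with ⟨h₁, h₂, h₃, h₄, h₅⟩ | ⟨h₁, h₂, h₃, h₄, h₅⟩ | ⟨h₁, h₂, h₃, h₄, h₅⟩ |
    ⟨h₁, h₂, h₃, h₄, h₅⟩ <;>
  rcases hq with ⟨k₁, k₂, k₃, k₄, k₅⟩ | ⟨k₁, k₂, k₃, k₄, k₅⟩ | ⟨k₁, k₂, k₃, k₄, k₅⟩ |
    ⟨k₁, k₂, k₃, k₄, k₅⟩ <;>
  simp only [h₁, h₂, h₃, h₄, h₅, k₁, k₂, k₃, k₄, k₅] <;> norm_num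

lemma compat_cells {A B C D S : Finset M}
    (h : ∀ x, (x ∈ A ∧ x ∉ B ∧ x ∉ C ∧ x ∉ D ∧ x ∈ S) ∨
      (x ∉ A ∧ x ∈ B ∧ x ∉ C ∧ x ∉ D ∧ x ∈ S) ∨ (x ∉ A ∧ x ∉ B ∧ x ∈ C ∧ x ∉ D ∧ x ∉ S) ∨
      (x ∉ A ∧ x ∉ B ∧ x ∉ C ∧ x ∈ D ∧ x ∉ S)) :
    ∀ X ∈ ({A, B, C, D, A ∪ C} : Set (Finset M)),
      ∀ Y ∈ ({A, B, C, D, A ∪ C} : Set (Finset M)), Compat X Y := by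
  have dis : ∀ {X Y : Finset M}, (∀ x ∈ X, x ∉ Y) → Compat X Y := fun h => .inr (.inr (.inl h))
  have hA : ∀ x ∈ A, x ∉ B ∧ x ∉ C ∧ x ∉ D := fun x hx => by
    rcases h x with ⟨h₁, h₂, h₃, h₄, -⟩ | h | h | h
    · exact ⟨h₂, h₃, h₄⟩
    all_goals exact absurd hx h.1
  have hB : ∀ x ∈ B, x ∉ A ∧ x ∉ C ∧ x ∉ D := fun x hx => by
    rcases h x with h | ⟨h₁, h₂, h₃, h₄, -⟩ | h | h
    · exact absurd hx h.2.1
    · exact ⟨h₁, h₃, h₄⟩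
    all_goals exact absurd hx h.2.1
  have hD : ∀ x ∈ D, x ∉ A ∧ x ∉ B ∧ x ∉ C := fun x hx => by
    rcases h x with h | h | h | ⟨h₁, h₂, h₃, h₄, -⟩
    · exact absurd hx h.2.2.2.1
    · exact absurd hx h.2.2.2.1
    · exact absurd hx h.2.2.2.1
    · exact ⟨h₁, h₂, h₃⟩
  have hAB : Compat A B := dis fun x hx => (hA x hx).1
  have hAC : Compat A C := dis fun x hx => (hA x hx).2.1
  have hAD : Compat A D := dis fun x hx => (hA x hx).2.2
  have hBC : Compat B C := dis fun x hx => (hB x hx).2.1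
  have hBD : Compat B D := dis fun x hx => (hB x hx).2.2
  have hDC : Compat D C := dis fun x hx => (hD x hx).2.2
  have hAU : Compat A (A ∪ C) := .inl fun x hx => Finset.mem_union_left _ hx
  have hCU : Compat C (A ∪ C) := .inl fun x hx => Finset.mem_union_right _ hx
  have hBU : Compat B (A ∪ C) := dis fun x hx => by
    rw [Finset.mem_union, not_or]
    exact ⟨(hB x hx).1, (hB x hx).2.1⟩
  have hDU : Compat D (A ∪ C) := dis fun x hx => by
    rw [Finset.mem_union, not_or]
    exact ⟨(hD x hx).1, (hD x hx).2.2⟩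
  intro X hX Y hY
  simp only [Set.mem_insert_iff, Set.mem_singleton_iff] at hX hY
  rcases hX with rfl | rfl | rfl | rfl | rfl <;>
    rcases hY with rfl | rfl | rfl | rfl | rfl <;>
    first | exact compat_self _ | assumption | (apply Compat.symm; assumption)

/-- A negative inner split can be exchanged for a positive transversal one without changing
the total weight or decreasing any distance. -/
lemma exists_splitDist_lt_of_neg {r : M} {w : Finset M → ℝ}
    (hw : IsSplitFamily r {T | w T ≠ 0}) {S : Finset M} (hS : w S < 0)
    (hin : S.Nontrivial) (hout : Sᶜ.Nontrivial) :
    ∃ w' : Finset M → ℝ, IsSplitFamily r {T | w' T ≠ 0} ∧ splitWeight w' = splitWeight w ∧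
      (∀ p q, splitDist w p q ≤ splitDist w' p q) ∧
      ∃ p q, splitDist w p q < splitDist w' p q := by
  have hSF : S ∈ {T | w T ≠ 0} := hS.ne
  have hTS : ∀ T ∈ {T | w T ≠ 0}, Compat T S := fun T hT => hw.compat T hT S hSF
  obtain ⟨A, B, ⟨a, ha⟩, ⟨b, hb⟩, hAB, hABS, hA, hB⟩ :=
    exists_compat_partition hw.compat hTS hin
  obtain ⟨C, D, ⟨c, hc⟩, ⟨d, hd⟩, hCD, hCDS, hC, hD⟩ :=
    exists_compat_partition hw.compat
      (fun T hT => (compat_compl_left.2 (hTS T hT).symm).symm) hout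
  have m₁ : ∀ x, x ∈ S ↔ x ∈ A ∨ x ∈ B := fun x => by simp [← hABS]
  have m₂ : ∀ x, x ∉ S ↔ x ∈ C ∨ x ∈ D := fun x => by
    rw [← Finset.mem_compl, ← hCDS, Finset.mem_union]
  have m₃ : ∀ x, x ∈ A → x ∉ B := Finset.disjoint_left.1 hAB
  have m₄ : ∀ x, x ∈ C → x ∉ D := Finset.disjoint_left.1 hCD
  set ε := - w S with hε
  have hεpos : 0 < ε := by linarith
  let w' : Finset M → ℝ := w + Pi.single S ε + Pi.single (unrooted r A) (-(ε / 2))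
    + Pi.single (unrooted r B) (-(ε / 2)) + Pi.single (unrooted r C) (-(ε / 2))
    + Pi.single (unrooted r D) (-(ε / 2)) + Pi.single (unrooted r (A ∪ C)) ε
  have hdist : ∀ p q, splitDist w' p q = splitDist w p q + ε * (sep S p q -
      (sep A p q + sep B p q + sep C p q + sep D p q) / 2 + sep (A ∪ C) p q) := by
    intro p q
    simp only [w', splitDist_add, splitDist_single, sep_unrooted]
    ring
  have hpart := mem_cells m₁ m₂ m₃ m₄
  have hdist' := fun p q => sep_cells_nonneg (hpart p) (hpart q)
  have pa : a ∈ A ∧ a ∉ B ∧ a ∉ C ∧ a ∉ D ∧ a ∈ S := by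
    rcases hpart a with h | h | h | h
    · exact h
    all_goals exact absurd ha h.1
  have pb : b ∉ A := fun h => m₃ b h hb
  have pd : d ∉ A ∧ d ∉ B ∧ d ∉ C ∧ d ∈ D ∧ d ∉ S := by
    rcases hpart d with h | h | h | h
    · exact absurd hd h.2.2.2.1
    · exact absurd hd h.2.2.2.1
    · exact absurd hd h.2.2.2.1
    · exact h
  refine ⟨w', ?_, ?_, ?_, a, d, ?_⟩
  · have hfam : IsSplitFamily r (({T | w T ≠ 0} \ {S}) ∪
        unrooted r '' ({A, B, C, D, A ∪ C} : Set (Finset M))) := by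
      refine (hw.mono Set.sdiff_subset).union_unrooted ?_ ?_ ?_
      · exact compat_cells hpart
      · rintro T ⟨hT, hTne⟩ X hX
        simp only [Set.mem_insert_iff, Set.mem_singleton_iff] at hX
        rcases hX with rfl | rfl | rfl | rfl | rfl
        · exact hA T hT
        · exact hB T hT
        · exact hC T hT
        · exact hD T hT
        · refine Compat.union_of_partition (hA T hT) (hB T hT) (hC T hT) (hD T hT) (hTS T hT)
            hAB hCD hABS hCDS hTne ?_
          rintro rfl
          exact hw.root_notMem _ hT (Finset.mem_compl.2 (hw.root_notMem _ hSF))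
      · intro X hX
        simp only [Set.mem_insert_iff, Set.mem_singleton_iff] at hX
        rcases hX with rfl | rfl | rfl | rfl | rfl
        · exact ⟨⟨a, ha⟩, ⟨b, Finset.mem_compl.2 pb⟩⟩
        · exact ⟨⟨b, hb⟩, ⟨a, Finset.mem_compl.2 pa.2.1⟩⟩
        · exact ⟨⟨c, hc⟩, ⟨a, Finset.mem_compl.2 pa.2.2.1⟩⟩
        · exact ⟨⟨d, hd⟩, ⟨a, Finset.mem_compl.2 pa.2.2.2.1⟩⟩
        · exact ⟨⟨a, Finset.mem_union_left _ ha⟩, ⟨d, by simp [pd]⟩⟩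
    refine hfam.mono ?_
    intro T hT
    by_contra hcon
    simp only [Set.mem_union, Set.mem_sdiff, Set.mem_ofPred_eq, Set.mem_singleton_iff,
      Set.mem_image, Set.mem_insert_iff, not_or, not_and, not_exists] at hcon
    obtain ⟨hcon₁, hcon₂⟩ := hcon
    have hX : ∀ X : Finset M, X = A ∨ X = B ∨ X = C ∨ X = D ∨ X = A ∪ C →
        T ≠ unrooted r X := fun X hX h => hcon₂ X hX h.symm
    apply hT
    simp only [w', Pi.add_apply, Pi.single_apply, hX A (by simp), hX B (by simp), hX C (by simp),
      hX D (by simp), hX (A ∪ C) (by simp), if_false, add_zero]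
    by_cases hTS' : T = S
    · simp [hTS', hε]
    · simp only [hTS', if_false, add_zero]
      by_contra h
      exact hTS' (by simpa [h] using hcon₁)
  · simp only [w', splitWeight_add, splitWeight_single]
    ring
  · intro p q
    rw [hdist]
    nlinarith [hdist' p q]
  · rw [hdist]
    simp [sep, pa, pd, hεpos]

/-- Only the split `{a}` separates `a` from both `p ∈ C` and `q ∈ D`, when `C` and `D`
partition the complement of `a` compatibly. -/
lemma sep_eq_add_of_compat {a p q : M} {C D T : Finset M} (hp : p ∈ C) (hq : q ∈ D)
    (hcov : ∀ x, x = a ∨ x ∈ C ∨ x ∈ D) (haC : a ∉ C) (haD : a ∉ D)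
    (hCD : ∀ x ∈ C, x ∉ D) (hC : Compat T C) (hD : Compat T D)
    (h₁ : T ≠ {a}) (h₂ : T ≠ {a}ᶜ) :
    sep T p q = sep T p a + sep T a q := by
  have n₁ : ¬ ∀ x, x ∈ T ↔ x = a := fun h => h₁ (Finset.ext fun x => by simp [h])
  have n₂ : ¬ ∀ x, x ∈ T ↔ x ≠ a := fun h => h₂ (Finset.ext fun x => by simp [h])
  clear h₁ h₂
  unfold Compat at hC hD
  have key : (a ∈ T ↔ p ∈ T) ∨ (a ∈ T ↔ q ∈ T) := by
    by_contra hcon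
    by_cases haT : a ∈ T
    · have hpT : p ∉ T := by tauto
      have hqT : q ∉ T := by tauto
      apply n₁
      grind
    · have hpT : p ∈ T := by tauto
      have hqT : q ∈ T := by tauto
      apply n₂
      grind
  unfold sep
  by_cases h1 : p ∈ T <;> by_cases h2 : q ∈ T <;> by_cases h3 : a ∈ T <;>
    simp [h1, h2, h3] at key ⊢

/-- A negative weight on the split cutting off one point is not optimal. -/
lemma exists_splitWeight_lt_of_neg {r : M} {ρ : M → M → ℝ} (hρ : IsPseudometric ρ)
    {w : Finset M → ℝ} (hw : IsSplitFamily r {T | w T ≠ 0})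
    (hd : ∀ p q, ρ p q ≤ splitDist w p q) {a : M} (hneg : w (unrooted r {a}) < 0)
    (hout : ({a}ᶜ : Finset M).Nontrivial) :
    ∃ w' : Finset M → ℝ, IsSplitFamily r {T | w' T ≠ 0} ∧
      (∀ p q, ρ p q ≤ splitDist w' p q) ∧ splitWeight w' < splitWeight w := by
  obtain ⟨C, D, ⟨c, hc⟩, ⟨d, hd'⟩, hCD, hCDa, hC, hD⟩ :=
    exists_compat_partition (S := {a}ᶜ) hw.compat
      (fun T _ => (compat_compl_left.2
        (by unfold Compat; by_cases h : a ∈ T <;> simp [h])).symm) hout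
  have m₂ : ∀ x, x ≠ a ↔ x ∈ C ∨ x ∈ D := fun x => by
    rw [← Finset.mem_union, hCDa]; simp
  have m₄ : ∀ x, x ∈ C → x ∉ D := Finset.disjoint_left.1 hCD
  set ε := - w (unrooted r {a}) with hε
  have hεpos : 0 < ε := by linarith
  let w' : Finset M → ℝ := w + Pi.single (unrooted r {a}) ε + Pi.single (unrooted r C) (-ε)
    + Pi.single (unrooted r D) (-ε)
  have hdist : ∀ p q, splitDist w' p q = splitDist w p q + ε * (sep {a} p q -
      sep C p q - sep D p q) := by
    intro p q
    simp only [w', splitDist_add, splitDist_single, sep_unrooted]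
    ring
  have hpart : ∀ x, (x ∈ ({a} : Finset M) ∧ x ∉ C ∧ x ∉ D) ∨
      (x ∉ ({a} : Finset M) ∧ x ∈ C ∧ x ∉ D) ∨ (x ∉ ({a} : Finset M) ∧ x ∉ C ∧ x ∈ D) := by
    intro x
    rw [Finset.mem_singleton]
    have h₁ := m₂ x
    have h₂ := m₄ x
    tauto
  have hslack : ∀ p q, ((p ∈ C ∧ q ∈ D) ∨ (p ∈ D ∧ q ∈ C)) →
      splitDist w p q = splitDist w p a + splitDist w a q + 2 * ε := by
    intro p q hpq
    have hpa : p ≠ a := (m₂ p).2 (by tauto)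
    have hqa : q ≠ a := (m₂ q).2 (by tauto)
    have : ∀ T, w T * sep T p q = w T * sep T p a + w T * sep T a q +
        if T = unrooted r {a} then 2 * ε else 0 := by
      intro T
      split_ifs with hT
      · subst hT
        rw [sep_unrooted]
        simp only [sep, Finset.mem_singleton, hpa, hqa, hε]
        norm_num
        ring
      · rcases eq_or_ne (w T) 0 with h0 | h0
        · simp [h0]
        · have hrT : r ∉ T := hw.root_notMem T h0
          have h₁ : T ≠ {a} := by
            rintro rfl
            exact hT (by simp only [unrooted, hrT, if_false])
          have h₂ : T ≠ {a}ᶜ := by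
            rintro rfl
            rw [Finset.mem_compl, not_not] at hrT
            exact hT (by simp only [unrooted, hrT, if_true])
          have haC : a ∉ C := fun h => (m₂ a).2 (Or.inl h) rfl
          have haD : a ∉ D := fun h => (m₂ a).2 (Or.inr h) rfl
          rw [add_zero, ← mul_add]
          congr 1
          rcases hpq with ⟨hp, hq⟩ | ⟨hp, hq⟩
          · exact sep_eq_add_of_compat hp hq (fun x => by have := m₂ x; tauto) haC haD m₄
              (hC T h0) (hD T h0) h₁ h₂
          · exact sep_eq_add_of_compat hp hq (fun x => by have := m₂ x; tauto) haD haC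
              (fun x h h' => m₄ x h' h) (hD T h0) (hC T h0) h₁ h₂
    unfold splitDist
    rw [Finset.sum_congr rfl fun T _ => this T]
    simp [Finset.sum_add_distrib]
  refine ⟨w', ?_, ?_, ?_⟩
  · have hfam : IsSplitFamily r ({T | w T ≠ 0} ∪
        unrooted r '' ({C, D} : Set (Finset M))) := by
      refine hw.union_unrooted ?_ ?_ ?_
      · intro X hX Y hY
        simp only [Set.mem_insert_iff, Set.mem_singleton_iff] at hX hY
        have hCD' : Compat C D := .inr (.inr (.inl m₄))
        rcases hX with rfl | rfl <;> rcases hY with rfl | rfl <;>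
          first | exact compat_self _ | assumption | (apply Compat.symm; assumption)
      · rintro T hT X hX
        simp only [Set.mem_insert_iff, Set.mem_singleton_iff] at hX
        rcases hX with rfl | rfl
        · exact hC T hT
        · exact hD T hT
      · intro X hX
        simp only [Set.mem_insert_iff, Set.mem_singleton_iff] at hX
        rcases hX with rfl | rfl
        · exact ⟨⟨c, hc⟩, ⟨d, Finset.mem_compl.2 fun h => m₄ d h hd'⟩⟩
        · exact ⟨⟨d, hd'⟩, ⟨c, Finset.mem_compl.2 (m₄ c hc)⟩⟩
    refine hfam.mono ?_
    intro T hT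
    by_contra hcon
    simp only [Set.mem_union, Set.mem_ofPred_eq, not_not,
      Set.mem_image, Set.mem_insert_iff, Set.mem_singleton_iff, not_or, not_and,
      not_exists] at hcon
    obtain ⟨hcon₁, hcon₂⟩ := hcon
    have h₁ : T ≠ unrooted r C := fun h => hcon₂ C (by simp) h.symm
    have h₂ : T ≠ unrooted r D := fun h => hcon₂ D (by simp) h.symm
    apply hT
    have h₃ : T ≠ unrooted r {a} := by rintro rfl; linarith
    simp [w', h₁, h₂, h₃, hcon₁]
  · intro p q
    rw [hdist]
    have h0 := hd p q
    have h1 := hd p a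
    have h2 := hd a q
    have h3 := hρ.2.2.2 p a q
    have h4 := hslack p q
    have e : ∀ X : Finset M, ∀ {x y : M}, x ∈ X → y ∈ X → sep X x y = 0 :=
      fun X x y hx hy => by simp [sep, hx, hy]
    have e' : ∀ X : Finset M, ∀ {x y : M}, x ∉ X → y ∉ X → sep X x y = 0 :=
      fun X x y hx hy => by simp [sep, hx, hy]
    have f : ∀ X : Finset M, ∀ {x y : M}, x ∈ X → y ∉ X → sep X x y = 1 :=
      fun X x y hx hy => by simp [sep, hx, hy]
    have f' : ∀ X : Finset M, ∀ {x y : M}, x ∉ X → y ∈ X → sep X x y = 1 :=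
      fun X x y hx hy => by simp [sep, hx, hy]
    rcases hpart p with ⟨hp, hpC, hpD⟩ | ⟨hp, hpC, hpD⟩ | ⟨hp, hpC, hpD⟩ <;>
      rcases hpart q with ⟨hq, hqC, hqD⟩ | ⟨hq, hqC, hqD⟩ | ⟨hq, hqC, hqD⟩
    · rw [e _ hp hq, e' _ hpC hqC, e' _ hpD hqD]; linarith
    · rw [f _ hp hq, f' _ hpC hqC, e' _ hpD hqD]; linarith
    · rw [f _ hp hq, e' _ hpC hqC, f' _ hpD hqD]; linarith
    · rw [f' _ hp hq, f _ hpC hqC, e' _ hpD hqD]; linarith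
    · rw [e' _ hp hq, e _ hpC hqC, e' _ hpD hqD]; linarith
    · rw [e' _ hp hq, f _ hpC hqC, f' _ hpD hqD]
      linarith [h4 (.inl ⟨hpC, hqD⟩)]
    · rw [f' _ hp hq, e' _ hpC hqC, f _ hpD hqD]; linarith
    · rw [e' _ hp hq, f' _ hpC hqC, f _ hpD hqD]
      linarith [h4 (.inr ⟨hpD, hqC⟩)]
    · rw [e' _ hp hq, e' _ hpC hqC, e _ hpD hqD]; linarith
  · simp only [w', splitWeight_add, splitWeight_single]
    linarith

end SplitOps

section Averaging

variable {M : Type*} [Fintype M] [DecidableEq M]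

/-- `lam` and `mu` are positive weights on the pairs of distinct points, and on the points, of
`S`, such that every member of `F` inside `S` has total mass one: the pairs it separates
together with its points. -/
structure IsAveraging (F : Set (Finset M)) (S : Finset M) (lam : M → M → ℝ) (mu : M → ℝ) :
    Prop where
  lam_nonneg : ∀ p q, 0 ≤ lam p q
  lam_zero : ∀ p q, ¬ (p ∈ S ∧ q ∈ S) → lam p q = 0
  lam_pos : ∀ p ∈ S, ∀ q ∈ S, p ≠ q → 0 < lam p q
  mu_nonneg : ∀ p, 0 ≤ mu p
  mu_pos : ∀ p ∈ S, 0 < mu p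
  mu_zero : ∀ p, p ∉ S → mu p = 0
  mu_sum : ∑ p, mu p = 1
  mass : ∀ T ∈ F, T ⊆ S → ∑ p, ∑ q, lam p q * sep T p q + ∑ p ∈ T, mu p = 1

lemma sep_comm (T : Finset M) (p q : M) : sep T p q = sep T q p := by
  unfold sep; simp only [iff_comm]

lemma sep_eq_zero_of_notMem {T : Finset M} {p q : M} (hp : p ∉ T) (hq : q ∉ T) :
    sep T p q = 0 := by simp [sep, hp, hq]

lemma sum_mul_sep_eq_zero {T B : Finset M} {lam : M → M → ℝ} (hTB : Disjoint T B)
    (hlam : ∀ p q, ¬ (p ∈ B ∧ q ∈ B) → lam p q = 0) :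
    ∑ p, ∑ q, lam p q * sep T p q = 0 := by
  refine Finset.sum_eq_zero fun p _ => Finset.sum_eq_zero fun q _ => ?_
  by_cases h : p ∈ B ∧ q ∈ B
  · rw [sep_eq_zero_of_notMem (Finset.disjoint_right.1 hTB h.1)
      (Finset.disjoint_right.1 hTB h.2), mul_zero]
  · rw [hlam p q h, zero_mul]

/-- The mass of the product of two measures separated by a set meeting only the support of
the first one. -/
lemma sum_prod_sep {T A B : Finset M} {f g : M → ℝ} (hTA : T ⊆ A) (hAB : Disjoint A B)
    (hg : ∀ p, p ∉ B → g p = 0) (hg1 : ∑ p, g p = 1) :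
    ∑ p, ∑ q, f p * g q * sep T p q = ∑ p ∈ T, f p := by
  have : ∀ p, ∑ q, f p * g q * sep T p q = if p ∈ T then f p else 0 := by
    intro p
    have : ∀ q, f p * g q * sep T p q = (if p ∈ T then f p else 0) * g q := by
      intro q
      by_cases hq : q ∈ B
      · have hqT : q ∉ T := fun h => Finset.disjoint_right.1 hAB hq (hTA h)
        by_cases hp : p ∈ T <;> simp [sep, hp, hqT]
      · simp [hg q hq]
    rw [Finset.sum_congr rfl fun q _ => this q, ← Finset.mul_sum, hg1, mul_one]
  rw [Finset.sum_congr rfl fun p _ => this p]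
  simp

lemma IsAveraging.mass_union_left {F : Set (Finset M)} {A B T : Finset M}
    {lA lB : M → M → ℝ} {mA mB : M → ℝ} (hA : IsAveraging F A lA mA)
    (hB : IsAveraging F B lB mB) (hAB : Disjoint A B) (hT : T ∈ F) (hTA : T ⊆ A) :
    ∑ p, ∑ q, (lA p q + lB p q + (mA p * mB q + mA q * mB p) / 4) * sep T p q +
      ∑ p ∈ T, (mA p + mB p) / 2 = 1 := by
  have h₁ := hA.mass T hT hTA
  have h₂ := sum_mul_sep_eq_zero (hAB.mono_left hTA) hB.lam_zero
  have h₃ := sum_prod_sep (f := mA) hTA hAB hB.mu_zero hB.mu_sum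
  have h₄ : ∑ p, ∑ q, mA q * mB p * sep T p q = ∑ p ∈ T, mA p := by
    rw [← h₃, Finset.sum_comm]
    refine Finset.sum_congr rfl fun p _ => Finset.sum_congr rfl fun q _ => ?_
    rw [sep_comm]
  have h₅ : ∑ p ∈ T, mB p = 0 := Finset.sum_eq_zero fun p hp =>
    hB.mu_zero p (Finset.disjoint_left.1 hAB (hTA hp))
  have h₆ : ∑ p, ∑ q, (lA p q + lB p q + (mA p * mB q + mA q * mB p) / 4) * sep T p q =
      ∑ p, ∑ q, lA p q * sep T p q + ∑ p, ∑ q, lB p q * sep T p q +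
      (∑ p, ∑ q, mA p * mB q * sep T p q + ∑ p, ∑ q, mA q * mB p * sep T p q) / 4 := by
    simp only [← Finset.sum_add_distrib, Finset.sum_div]
    refine Finset.sum_congr rfl fun p _ => Finset.sum_congr rfl fun q _ => ?_
    ring
  rw [h₆, h₂, h₃, h₄, ← Finset.sum_div, Finset.sum_add_distrib, h₅]
  linarith

lemma IsAveraging.union {F : Set (Finset M)} {r : M} (hF : IsSplitFamily r F) {A B : Finset M}
    {lA lB : M → M → ℝ} {mA mB : M → ℝ} (hA : IsAveraging F A lA mA)
    (hB : IsAveraging F B lB mB) (hAB : Disjoint A B) (hr : r ∉ A ∪ B)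
    (hFA : ∀ T ∈ F, Compat T A) (hFB : ∀ T ∈ F, Compat T B) :
    IsAveraging F (A ∪ B)
      (fun p q => lA p q + lB p q + (mA p * mB q + mA q * mB p) / 4)
      (fun p => (mA p + mB p) / 2) where
  lam_nonneg p q := by
    have := hA.lam_nonneg p q
    have := hB.lam_nonneg p q
    have := mul_nonneg (hA.mu_nonneg p) (hB.mu_nonneg q)
    have := mul_nonneg (hA.mu_nonneg q) (hB.mu_nonneg p)
    linarith
  lam_zero p q h := by
    simp only [Finset.mem_union] at h
    have h₁ : mA p * mB q = 0 := by
      by_cases hp : p ∈ A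
      · rw [hB.mu_zero q (by tauto), mul_zero]
      · rw [hA.mu_zero p hp, zero_mul]
    have h₂ : mA q * mB p = 0 := by
      by_cases hp : p ∈ B
      · rw [hA.mu_zero q (by tauto), zero_mul]
      · rw [hB.mu_zero p hp, mul_zero]
    rw [hA.lam_zero p q (by tauto), hB.lam_zero p q (by tauto), h₁, h₂]
    norm_num
  lam_pos p hp q hq hpq := by
    have n₁ := hA.lam_nonneg p q
    have n₂ := hB.lam_nonneg p q
    have n₃ := mul_nonneg (hA.mu_nonneg p) (hB.mu_nonneg q)
    have n₄ := mul_nonneg (hA.mu_nonneg q) (hB.mu_nonneg p)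
    rcases Finset.mem_union.1 hp with hp | hp <;> rcases Finset.mem_union.1 hq with hq | hq
    · linarith [hA.lam_pos p hp q hq hpq]
    · linarith [mul_pos (hA.mu_pos p hp) (hB.mu_pos q hq)]
    · linarith [mul_pos (hA.mu_pos q hq) (hB.mu_pos p hp)]
    · linarith [hB.lam_pos p hp q hq hpq]
  mu_nonneg p := by linarith [hA.mu_nonneg p, hB.mu_nonneg p]
  mu_pos p hp := by
    rcases Finset.mem_union.1 hp with hp | hp
    · linarith [hA.mu_pos p hp, hB.mu_nonneg p]
    · linarith [hB.mu_pos p hp, hA.mu_nonneg p]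
  mu_zero p hp := by
    rw [Finset.mem_union, not_or] at hp
    rw [hA.mu_zero p hp.1, hB.mu_zero p hp.2]
    norm_num
  mu_sum := by
    rw [← Finset.sum_div, Finset.sum_add_distrib, hA.mu_sum, hB.mu_sum]
    norm_num
  mass T hT hTS := by
    have hleft := fun h => hA.mass_union_left hB hAB hT h
    have hright : T ⊆ B →
        ∑ p, ∑ q, (lA p q + lB p q + (mA p * mB q + mA q * mB p) / 4) * sep T p q +
          ∑ p ∈ T, (mA p + mB p) / 2 = 1 := by
      intro h
      rw [← hB.mass_union_left hA hAB.symm hT h]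
      congr 1
      · refine Finset.sum_congr rfl fun p _ => Finset.sum_congr rfl fun q _ => ?_
        ring
      · refine Finset.sum_congr rfl fun p _ => ?_
        ring
    have hTS' : ∀ x ∈ T, x ∈ A ∨ x ∈ B := fun x hx => Finset.mem_union.1 (hTS hx)
    rw [Finset.mem_union, not_or] at hr
    have hrT := hF.root_notMem T hT
    rcases hFA T hT with h | h | h | h
    · exact hleft h
    · rcases hFB T hT with h' | h' | h' | h'
      · exact hright h'
      · have : T = A ∪ B := Finset.Subset.antisymm hTS (Finset.union_subset h h')
        subst this
        have hz : ∑ p, ∑ q, (lA p q + lB p q + (mA p * mB q + mA q * mB p) / 4) *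
            sep (A ∪ B) p q = 0 := by
          refine Finset.sum_eq_zero fun p _ => Finset.sum_eq_zero fun q _ => ?_
          by_cases hp : p ∈ A ∪ B ∧ q ∈ A ∪ B
          · rw [show sep (A ∪ B) p q = 0 by simp only [sep, hp.1, hp.2, if_true], mul_zero]
          · rw [Finset.mem_union, Finset.mem_union] at hp
            have h₁ : mA p * mB q = 0 := by
              by_cases hp' : p ∈ A
              · rw [hB.mu_zero q (by tauto), mul_zero]
              · rw [hA.mu_zero p hp', zero_mul]
            have h₂ : mA q * mB p = 0 := by
              by_cases hp' : p ∈ B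
              · rw [hA.mu_zero q (by tauto), zero_mul]
              · rw [hB.mu_zero p hp', mul_zero]
            rw [hA.lam_zero p q (by tauto), hB.lam_zero p q (by tauto), h₁, h₂]
            norm_num
        rw [hz, zero_add, Finset.sum_subset (Finset.subset_univ _), ← Finset.sum_div,
          Finset.sum_add_distrib, hA.mu_sum, hB.mu_sum]
        · norm_num
        · intro p _ hp
          rw [Finset.mem_union, not_or] at hp
          rw [hA.mu_zero p hp.1, hB.mu_zero p hp.2]
          norm_num
      · exact hleft fun x hx => (hTS' x hx).resolve_right (h' x hx)
      · exact absurd (h' r) (by tauto)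
    · exact hright fun x hx => (hTS' x hx).resolve_left (h x hx)
    · exact absurd (h r) (by tauto)

lemma isAveraging_singleton {F : Set (Finset M)} {r : M} (hF : IsSplitFamily r F) (a : M) :
    IsAveraging F {a} 0 (Pi.single a 1) where
  lam_nonneg _ _ := le_rfl
  lam_zero _ _ _ := rfl
  lam_pos p hp q hq h := by
    rw [Finset.mem_singleton] at hp hq
    exact absurd (hp.trans hq.symm) h
  mu_nonneg p := by rw [Pi.single_apply]; split_ifs <;> norm_num
  mu_pos p hp := by
    rw [Finset.mem_singleton] at hp
    simp [hp]
  mu_zero p hp := by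
    rw [Finset.mem_singleton] at hp
    simp [hp]
  mu_sum := by simp
  mass T hT hTa := by
    rw [(Finset.Nonempty.subset_singleton_iff (hF.nonempty T hT)).1 hTa]
    simp

lemma exists_isAveraging {F : Set (Finset M)} {r : M} (hF : IsSplitFamily r F) (n : ℕ) :
    ∀ S : Finset M, S.card = n → S.Nonempty → r ∉ S → (∀ T ∈ F, Compat T S) →
      ∃ lam mu, IsAveraging F S lam mu := by
  induction n using Nat.strong_induction_on with
  | _ n ih =>
    intro S hn hne hr hS
    rcases hne.exists_eq_singleton_or_nontrivial with ⟨a, rfl⟩ | h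
    · exact ⟨_, _, isAveraging_singleton hF a⟩
    · obtain ⟨A, B, hA, hB, hAB, rfl, hFA, hFB⟩ := exists_compat_partition hF.compat hS h
      have hcard := Finset.card_union_of_disjoint hAB
      have hA' := hA.card_pos
      have hB' := hB.card_pos
      have hr' := hr
      rw [Finset.mem_union, not_or] at hr'
      obtain ⟨lA, mA, h₁⟩ := ih A.card (by omega) A rfl hA hr'.1 hFA
      obtain ⟨lB, mB, h₂⟩ := ih B.card (by omega) B rfl hB hr'.2 hFB
      exact ⟨_, _, h₁.union hF h₂ hAB hr hFA hFB⟩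

/-- A total weight is a combination of distances with positive coefficients. -/
lemma exists_weight_eq_sum_dist {F : Set (Finset M)} {r : M} (hF : IsSplitFamily r F) :
    ∃ lam : M → M → ℝ, (∀ p q, 0 ≤ lam p q) ∧ (∀ p q, p ≠ q → 0 < lam p q ∨ 0 < lam q p) ∧
      ∀ w : Finset M → ℝ, (∀ T, T ∉ F → w T = 0) →
        splitWeight w = ∑ p, ∑ q, lam p q * splitDist w p q := by
  suffices h : ∃ lam : M → M → ℝ, (∀ p q, 0 ≤ lam p q) ∧
      (∀ p q, p ≠ q → 0 < lam p q ∨ 0 < lam q p) ∧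
      ∀ T ∈ F, ∑ p, ∑ q, lam p q * sep T p q = 1 by
    obtain ⟨lam, h₀, h₁, h₂⟩ := h
    refine ⟨lam, h₀, h₁, fun w hw => ?_⟩
    have : ∀ T, w T = ∑ p, ∑ q, lam p q * (w T * sep T p q) := by
      intro T
      by_cases hT : T ∈ F
      · calc w T = w T * ∑ p, ∑ q, lam p q * sep T p q := by rw [h₂ T hT, mul_one]
          _ = _ := by
            simp only [Finset.mul_sum]
            refine Finset.sum_congr rfl fun p _ => Finset.sum_congr rfl fun q _ => ?_
            ring
      · simp [hw T hT]
    unfold splitWeight splitDist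
    rw [Finset.sum_congr rfl fun T _ => this T]
    simp only [Finset.mul_sum]
    rw [Finset.sum_comm]
    refine Finset.sum_congr rfl fun p _ => ?_
    rw [Finset.sum_comm]
  by_cases hne : ({r}ᶜ : Finset M).Nonempty
  · obtain ⟨lam, mu, h⟩ := exists_isAveraging hF _ {r}ᶜ rfl hne (by simp) fun T hT =>
      Or.inl fun x hx => by
        rw [Finset.mem_compl, Finset.mem_singleton]
        rintro rfl
        exact hF.root_notMem T hT hx
    refine ⟨fun p q => lam p q + if p = r then mu q else 0, ?_, ?_, ?_⟩
    · intro p q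
      have := h.lam_nonneg p q
      have := h.mu_nonneg q
      dsimp only
      split_ifs <;> linarith
    · intro p q hpq
      dsimp only
      have n₁ := h.lam_nonneg p q
      have n₂ := h.lam_nonneg q p
      by_cases hp : p = r
      · left
        have := h.mu_pos q (by simp; rintro rfl; exact hpq hp)
        rw [if_pos hp]
        linarith
      · by_cases hq : q = r
        · right
          have := h.mu_pos p (by simp [hp])
          rw [if_pos hq]
          linarith
        · left
          rw [if_neg hp, add_zero]
          exact h.lam_pos p (by simp [hp]) q (by simp [hq]) hpq
    · intro T hT
      have hrT := hF.root_notMem T hT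
      rw [← h.mass T hT fun x hx => by
        rw [Finset.mem_compl, Finset.mem_singleton]
        rintro rfl
        exact hrT hx]
      simp only [add_mul, Finset.sum_add_distrib]
      congr 1
      simp only [ite_mul, zero_mul]
      rw [Finset.sum_comm]
      simp [sep, hrT]
  · refine ⟨0, fun _ _ => le_rfl, ?_, ?_⟩
    · intro p q hpq
      rw [Finset.not_nonempty_iff_eq_empty, Finset.compl_eq_empty_iff] at hne
      have hx : ∀ x, x = r := fun x => Finset.mem_singleton.1 (hne ▸ Finset.mem_univ x)
      exact absurd ((hx p).trans (hx q).symm) hpq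
    · intro T hT
      obtain ⟨x, hx⟩ := hF.nonempty T hT
      refine absurd ⟨x, ?_⟩ hne
      rw [Finset.mem_compl, Finset.mem_singleton]
      rintro rfl
      exact hF.root_notMem T hT hx

end Averaging

section Optimal

variable {M : Type*} [Fintype M] [DecidableEq M]

/-- The split systems dominating `ρ`. -/
structure IsSplitFilling (r : M) (ρ : M → M → ℝ) (w : Finset M → ℝ) : Prop where
  family : IsSplitFamily r {T | w T ≠ 0}
  le_dist : ∀ p q, ρ p q ≤ splitDist w p q

lemma splitDist_self (w : Finset M → ℝ) (p : M) : splitDist w p p = 0 := by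
  simp [splitDist, sep]

lemma splitDist_comm (w : Finset M → ℝ) (p q : M) : splitDist w p q = splitDist w q p := by
  unfold splitDist
  simp only [sep_comm]

lemma exists_isSplitFilling (r : M) {ρ : M → M → ℝ} (hρ : IsPseudometric ρ) :
    ∃ w, IsSplitFilling r ρ w := by
  set c := ∑ p, ∑ q, ρ p q
  have hc : ∀ p q, ρ p q ≤ c := fun p q =>
    (Finset.single_le_sum (f := fun q => ρ p q) (fun q _ => hρ.2.1 p q)
      (Finset.mem_univ q)).trans
    (Finset.single_le_sum (f := fun p => ∑ q, ρ p q)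
      (fun p _ => Finset.sum_nonneg fun q _ => hρ.2.1 p q) (Finset.mem_univ p))
  have hc0 : 0 ≤ c := (hρ.2.1 r r).trans (hc r r)
  let w : Finset M → ℝ := fun T => if ∃ a, a ≠ r ∧ T = {a} then c else 0
  have hsupp : ∀ T, w T ≠ 0 → ∃ a, a ≠ r ∧ T = {a} := by
    intro T hT
    by_contra h
    exact hT (if_neg h)
  have hnn : ∀ T p q, 0 ≤ w T * sep T p q := by
    intro T p q
    refine mul_nonneg ?_ ?_
    · simp only [w]; split_ifs <;> [exact hc0; exact le_rfl]
    · unfold sep; split_ifs <;> norm_num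
  have hlow : ∀ p q, p ≠ q → p ≠ r → ρ p q ≤ splitDist w p q := by
    intro p q hpq hp
    have h := Finset.single_le_sum (f := fun T => w T * sep T p q) (fun T _ => hnn T p q)
      (Finset.mem_univ {p})
    have h₁ : w {p} = c := if_pos ⟨p, hp, rfl⟩
    have h₂ : sep {p} p q = 1 := by simp [sep, hpq.symm]
    simp only [h₁, h₂, mul_one] at h
    exact (hc p q).trans h
  refine ⟨w, ⟨?_, ?_, ?_⟩, ?_⟩
  · intro A hA B _
    obtain ⟨a, -, rfl⟩ := hsupp A hA
    unfold Compat
    by_cases h : a ∈ B <;> simp [h]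
  · intro A hA
    obtain ⟨a, ha, rfl⟩ := hsupp A hA
    simpa using ha.symm
  · intro A hA
    obtain ⟨a, -, rfl⟩ := hsupp A hA
    exact Finset.singleton_nonempty a
  · intro p q
    rcases eq_or_ne p q with rfl | hpq
    · rw [splitDist_self, hρ.2.2.1]
    · by_cases hp : p = r
      · rw [splitDist_comm, hρ.1]
        exact hlow q p hpq.symm fun hq => hpq (hp.trans hq.symm)
      · exact hlow p q hpq hp

/-- Distances and total weight as a linear function of the weights. -/
def splitMap (M : Type*) [Fintype M] [DecidableEq M] :
    (Finset M → ℝ) →ₗ[ℝ] (M → M → ℝ) × ℝ where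
  toFun w := (splitDist w, splitWeight w)
  map_add' v w := by
    refine Prod.ext ?_ (splitWeight_add v w)
    funext p q
    exact splitDist_add v w p q
  map_smul' c w := by
    refine Prod.ext ?_ ?_
    · funext p q
      simp [splitDist, Finset.mul_sum, mul_assoc]
    · simp [splitWeight, Finset.mul_sum]

/-- The weights supported on `F`. -/
def supportedOn (F : Set (Finset M)) : Submodule ℝ (Finset M → ℝ) where
  carrier := {w | ∀ T, T ∉ F → w T = 0}
  add_mem' h₁ h₂ T hT := by simp [h₁ T hT, h₂ T hT]
  zero_mem' _ _ := rfl
  smul_mem' c w h T hT := by simp [h T hT]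

lemma isCompact_image_supportedOn {r : M} {F : Set (Finset M)} (hF : IsSplitFamily r F)
    {ρ : M → M → ℝ} (hρ : IsPseudometric ρ) (W : ℝ) :
    IsCompact (((supportedOn F).map (splitMap M) : Set ((M → M → ℝ) × ℝ)) ∩
      {x | ρ ≤ x.1 ∧ x.2 ≤ W}) := by
  obtain ⟨lam, hlam, hpos, hsum⟩ := exists_weight_eq_sum_dist hF
  have hbd : ∀ p q, ∃ b, ∀ w ∈ supportedOn F, ρ ≤ splitDist w → splitWeight w ≤ W →
      splitDist w p q ≤ b := by
    have key : ∀ p q, ∀ w ∈ supportedOn F, ρ ≤ splitDist w → splitWeight w ≤ W →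
        lam p q * splitDist w p q ≤ W := by
      intro p q w hw hρw hW
      rw [hsum w hw] at hW
      have hnn : ∀ p q, 0 ≤ lam p q * splitDist w p q := fun p q =>
        mul_nonneg (hlam p q) ((hρ.2.1 p q).trans (hρw p q))
      refine le_trans ?_ hW
      exact (Finset.single_le_sum (f := fun q => lam p q * splitDist w p q)
          (fun q _ => hnn p q) (Finset.mem_univ q)).trans
        (Finset.single_le_sum (f := fun p => ∑ q, lam p q * splitDist w p q)
          (fun p _ => Finset.sum_nonneg fun q _ => hnn p q) (Finset.mem_univ p))
    intro p q
    rcases eq_or_ne p q with rfl | hpq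
    · exact ⟨0, fun w _ _ _ => (splitDist_self w p).le⟩
    · rcases hpos p q hpq with h | h
      · exact ⟨W / lam p q, fun w h₁ h₂ h₃ => by
          rw [le_div_iff₀ h, mul_comm]
          exact key p q w h₁ h₂ h₃⟩
      · exact ⟨W / lam q p, fun w h₁ h₂ h₃ => by
          rw [le_div_iff₀ h, mul_comm, splitDist_comm]
          exact key q p w h₁ h₂ h₃⟩
  choose b hb using hbd
  refine IsCompact.of_isClosed_subset (isCompact_Icc (a := (ρ, (0 : ℝ))) (b := (b, W))) ?_ ?_
  · refine (Submodule.closed_of_finiteDimensional _).inter ?_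
    exact (isClosed_le continuous_const continuous_fst).inter
      (isClosed_le continuous_snd continuous_const)
  · rintro _ ⟨⟨w, hw, rfl⟩, h₁, h₂⟩
    refine ⟨⟨h₁, ?_⟩, ⟨fun p q => hb p q w hw h₁ h₂, h₂⟩⟩
    change 0 ≤ splitWeight w
    rw [hsum w hw]
    exact Finset.sum_nonneg fun p _ => Finset.sum_nonneg fun q _ =>
      mul_nonneg (hlam p q) ((hρ.2.1 p q).trans (h₁ p q))

lemma isCompact_splitFillings (r : M) {ρ : M → M → ℝ} (hρ : IsPseudometric ρ) (W : ℝ) :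
    IsCompact {x | ∃ w, IsSplitFilling r ρ w ∧ splitWeight w ≤ W ∧ splitMap M w = x} := by
  have : {x | ∃ w, IsSplitFilling r ρ w ∧ splitWeight w ≤ W ∧ splitMap M w = x} =
      ⋃ F ∈ {F | IsSplitFamily r F}, (((supportedOn F).map (splitMap M) :
        Set ((M → M → ℝ) × ℝ)) ∩ {x | ρ ≤ x.1 ∧ x.2 ≤ W}) := by
    ext x
    simp only [Set.mem_ofPred_eq, Set.mem_iUnion, exists_prop]
    constructor
    · rintro ⟨w, hw, hW, rfl⟩
      exact ⟨_, hw.family, ⟨w, fun T hT => by simpa using hT, rfl⟩, hw.le_dist, hW⟩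
    · rintro ⟨F, hF, ⟨w, hw, rfl⟩, h₁, h₂⟩
      refine ⟨w, ⟨hF.mono ?_, h₁⟩, h₂, rfl⟩
      intro T hT
      by_contra h
      exact hT (hw T h)
  rw [this]
  exact (Set.toFinite _).isCompact_biUnion fun F hF => isCompact_image_supportedOn hF hρ W

/-- Among the split systems dominating `ρ` of least total weight, there is one with the
largest sum of distances. -/
lemma exists_lex_optimal (r : M) {ρ : M → M → ℝ} (hρ : IsPseudometric ρ) :
    ∃ w, IsSplitFilling r ρ w ∧ (∀ w', IsSplitFilling r ρ w' → splitWeight w ≤ splitWeight w') ∧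
      ∀ w', IsSplitFilling r ρ w' → splitWeight w' = splitWeight w →
        ∑ p, ∑ q, splitDist w' p q ≤ ∑ p, ∑ q, splitDist w p q := by
  obtain ⟨w₀, hw₀⟩ := exists_isSplitFilling r hρ
  obtain ⟨_, ⟨w₁, hw₁, hle₁, rfl⟩, hmin⟩ := (isCompact_splitFillings r hρ (splitWeight w₀)).exists_isMinOn
    ⟨_, w₀, hw₀, le_rfl, rfl⟩ (continuous_snd.continuousOn)
  have hmin' : ∀ w', IsSplitFilling r ρ w' → splitWeight w₁ ≤ splitWeight w' := by
    intro w' hw'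
    rcases le_total (splitWeight w') (splitWeight w₀) with h | h
    · exact hmin ⟨w', hw', h, rfl⟩
    · exact hle₁.trans h
  obtain ⟨_, ⟨w₂, hw₂, hle₂, rfl⟩, hmax⟩ :=
    (isCompact_splitFillings r hρ (splitWeight w₁)).exists_isMaxOn
    (f := fun x : (M → M → ℝ) × ℝ => ∑ p, ∑ q, x.1 p q)
    ⟨_, w₁, hw₁, le_rfl, rfl⟩ (by fun_prop)
  refine ⟨w₂, hw₂, fun w' hw' => hle₂.trans (hmin' w' hw'), fun w' hw' h => ?_⟩
  exact hmax ⟨w', hw', h.trans_le hle₂, rfl⟩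

/-- Some split system of least total weight has nonnegative weights. -/
theorem exists_nonneg_optimal (r : M) {ρ : M → M → ℝ} (hρ : IsPseudometric ρ) :
    ∃ w, IsSplitFilling r ρ w ∧ (∀ T, 0 ≤ w T) ∧
      ∀ w', IsSplitFilling r ρ w' → splitWeight w ≤ splitWeight w' := by
  obtain ⟨w, hw, hmin, hmax⟩ := exists_lex_optimal r hρ
  refine ⟨w, hw, fun S => ?_, hmin⟩
  by_contra! hS
  have hrS : r ∉ S := hw.family.root_notMem S hS.ne
  have hSne : S.Nonempty := hw.family.nonempty S hS.ne
  have hleaf : ∀ a, w (unrooted r {a}) < 0 → ¬ ({a}ᶜ : Finset M).Nontrivial := by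
    intro a ha hout
    obtain ⟨w', h₁, h₂, h₃⟩ := exists_splitWeight_lt_of_neg hρ hw.family hw.le_dist ha hout
    exact absurd (hmin w' ⟨h₁, h₂⟩) h₃.not_ge
  rcases hSne.exists_eq_singleton_or_nontrivial with ⟨a, rfl⟩ | hin
  · rw [Finset.mem_singleton] at hrS
    have hone : ({a}ᶜ : Finset M) = {r} := by
      have hne : ({a}ᶜ : Finset M).Nonempty := ⟨r, by simpa using hrS⟩
      rcases hne.exists_eq_singleton_or_nontrivial with ⟨b, hb⟩ | h
      · rw [hb, Finset.singleton_inj]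
        exact (Finset.mem_singleton.1 (hb ▸ (by simpa using hrS : r ∈ ({a}ᶜ : Finset M)))).symm
      · exact absurd h (hleaf a (by simpa [unrooted, hrS] using hS))
    have hall : ∀ x, x ≠ a → x = r := fun x hx =>
      Finset.mem_singleton.1 (hone ▸ (by simpa using hx : x ∈ ({a}ᶜ : Finset M)))
    have hdist : splitDist w a r = w {a} := by
      unfold splitDist
      rw [Finset.sum_eq_single {a}]
      · simp [sep, hrS]
      · intro T _ hT
        rcases eq_or_ne (w T) 0 with h | h
        · rw [h, zero_mul]
        · refine absurd ?_ hT
          obtain ⟨x, hx⟩ := hw.family.nonempty T h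
          have hr := hw.family.root_notMem T h
          have ha : ∀ y ∈ T, y = a := fun y hy => by
            by_contra hya
            exact hr (hall y hya ▸ hy)
          exact Finset.eq_singleton_iff_unique_mem.2 ⟨ha x hx ▸ hx, ha⟩
      · simp
    have := (hρ.2.1 a r).trans (hw.le_dist a r)
    linarith
  · have hne : Sᶜ.Nonempty := ⟨r, Finset.mem_compl.2 hrS⟩
    rcases hne.exists_eq_singleton_or_nontrivial with ⟨b, hb⟩ | hout
    · have hrb : r = b := Finset.mem_singleton.1 (hb ▸ Finset.mem_compl.2 hrS)
      subst hrb
      have hSr : S = {r}ᶜ := by rw [← hb, compl_compl]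
      exact hleaf r (by simpa [unrooted, ← hSr] using hS) (hSr ▸ hin)
    · obtain ⟨w', h₁, h₂, h₃, p, q, hpq⟩ := exists_splitDist_lt_of_neg hw.family hS hin hout
      have := hmax w' ⟨h₁, fun p q => (hw.le_dist p q).trans (h₃ p q)⟩ h₂
      refine absurd this (not_le.2 ?_)
      refine Finset.sum_lt_sum (fun p _ => Finset.sum_le_sum fun q _ => h₃ p q)
        ⟨p, Finset.mem_univ p, ?_⟩
      exact Finset.sum_lt_sum (fun q _ => h₃ p q) ⟨q, Finset.mem_univ q, hpq⟩

end Optimal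

section Realize

variable {M : Type*} [Fintype M] [DecidableEq M]

/-- The clusters which lie above a cluster or a point. -/
def Below (x : Finset M ⊕ M) (C : Finset M) : Prop :=
  Sum.elim (fun B => B ⊂ C) (fun m => m ∈ C) x

lemma exists_parent {r : M} {w : Finset M → ℝ} (hw : IsSplitFamily r {T | w T ≠ 0})
    (x : Finset M ⊕ M) :
    ∃ C, (C = Finset.univ ∨ w C ≠ 0) ∧ (∀ B, x = .inl B → w B = 0 → C = Finset.univ) ∧
      ((∀ B, x = .inl B → w B ≠ 0) →
        Below x C ∧ ∀ D, w D ≠ 0 → Below x D → C.card ≤ D.card) := by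
  classical
  by_cases hx : ∀ B, x = .inl B → w B ≠ 0
  · let cand : Finset (Finset M) := Finset.univ.filter fun C =>
      (C = Finset.univ ∨ w C ≠ 0) ∧ Below x C
    have hne : cand.Nonempty := by
      refine ⟨Finset.univ, ?_⟩
      simp only [cand, Finset.mem_filter, Finset.mem_univ, true_and, true_or]
      rcases x with B | m
      · refine Finset.ssubset_univ_iff.2 ?_
        rintro rfl
        exact hw.root_notMem _ (hx _ rfl) (Finset.mem_univ r)
      · exact Finset.mem_univ m
    obtain ⟨C, hC, hmin⟩ := cand.exists_min_image Finset.card hne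
    simp only [cand, Finset.mem_filter, Finset.mem_univ, true_and] at hC hmin
    exact ⟨C, hC.1, fun B hB h => absurd h (hx B hB),
      fun _ => ⟨hC.2, fun D hD hxD => hmin D ⟨Or.inr hD, hxD⟩⟩⟩
  · exact ⟨Finset.univ, Or.inl rfl, fun _ _ _ => rfl, fun h => absurd h hx⟩

lemma sum_map_ite_eq {α β : Type*} [Fintype α] [DecidableEq β] (e : α → β) (W : α → ℝ)
    (l : List β) : (l.map fun b => ∑ x, if e x = b then W x else 0).sum =
      ∑ x, (l.map fun b => if e x = b then W x else 0).sum := by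
  induction l with
  | nil => simp
  | cons b l ih => simp [ih, Finset.sum_add_distrib]

/-- A nonnegative split system is realised by a nonnegatively weighted graph. -/
theorem exists_filling_of_split {r : M} {ρ : M → M → ℝ} {w : Finset M → ℝ}
    (hw : IsSplitFilling r ρ w) (h0 : ∀ T, 0 ≤ w T) :
    ∃ (G : SimpleGraph (Finset M ⊕ M)) (ω : Sym2 (Finset M ⊕ M) → ℝ),
      IsGenFillingE G ⟨Sum.inr, Sum.inr_injective⟩ ω ρ ∧ (∀ e, 0 ≤ ω e) ∧
        graphWeight G ω ≤ splitWeight w := by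
  classical
  choose par hpar₁ hpar₂ hpar₃ using exists_parent hw.family
  let e : Finset M ⊕ M → Sym2 (Finset M ⊕ M) := fun x => s(x, .inl (par x))
  let W : Finset M ⊕ M → ℝ := Sum.elim w 0
  have hW : ∀ x, 0 ≤ W x := by rintro (A | m) <;> simp [W, h0]
  let G : SimpleGraph (Finset M ⊕ M) := SimpleGraph.fromRel fun x y => y = .inl (par x)
  let ω : Sym2 (Finset M ⊕ M) → ℝ := fun b => ∑ x, if e x = b then W x else 0
  have hω : ∀ b, 0 ≤ ω b := fun b => Finset.sum_nonneg fun x _ => by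
    split_ifs <;> [exact hW x; exact le_rfl]
  have hroot : w Finset.univ = 0 := by
    by_contra h
    exact hw.family.root_notMem _ h (Finset.mem_univ r)
  have hstep : ∀ x, G.Reachable x (.inl (par x)) := by
    intro x
    rcases eq_or_ne x (.inl (par x)) with h | h
    · rw [← h]
    · exact SimpleGraph.Adj.reachable ((SimpleGraph.fromRel_adj _ _ _).2 ⟨h, Or.inl rfl⟩)
  have hreach : ∀ n, ∀ A : Finset M, Fintype.card M - A.card = n →
      G.Reachable (.inl A) (.inl Finset.univ) := by
    intro n
    induction n using Nat.strong_induction_on with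
    | _ n ih =>
      intro A hn
      by_cases hA : w A = 0
      · have := hstep (.inl A)
        rwa [hpar₂ (.inl A) A rfl hA] at this
      · have hlt : A ⊂ par (.inl A) :=
          (hpar₃ (.inl A) fun B hB => by rwa [← Sum.inl_injective hB]).1
        have hc := Finset.card_lt_card hlt
        have hc' := Finset.card_le_univ (par (.inl A))
        exact (hstep (.inl A)).trans (ih _ (by omega) (par (.inl A)) rfl)
  have hreach' : ∀ x, G.Reachable x (.inl Finset.univ) := fun x =>
    (hstep x).trans (hreach _ _ rfl)
  have hconn : G.Connected :=
    { preconnected := fun x y => (hreach' x).trans (hreach' y).symm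
      nonempty := ⟨.inl Finset.univ⟩ }
  -- the edge above a cluster is on every walk leaving the cluster
  have hcross : ∀ A, w A ≠ 0 → ∀ p ∈ A, ∀ q, q ∉ A → ∀ γ : G.Walk (.inr p) (.inr q),
      e (.inl A) ∈ γ.edges := by
    intro A hA p hp q hq γ
    have hrA := hw.family.root_notMem A hA
    let S : Set (Finset M ⊕ M) :=
      {x | Sum.elim (fun B => w B ≠ 0 ∧ B ⊆ A) (fun m => m ∈ A) x}
    obtain ⟨⟨⟨x, y⟩, hadj⟩, hd, hx, hy⟩ := γ.exists_boundary_dart S hp hq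
    have hmem : s(x, y) ∈ γ.edges := List.mem_map.2 ⟨_, hd, rfl⟩
    change x ∈ S at hx
    change y ∉ S at hy
    rcases ((SimpleGraph.fromRel_adj _ _ _).1 hadj).2 with h | h
    · dsimp only at h
      subst h
      by_cases hxA : x = .inl A
      · subst hxA; exact hmem
      · exfalso
        have hsupp : ∀ B, x = .inl B → w B ≠ 0 := by
          rintro B rfl
          exact hx.1
        have hbelow : Below x A := by
          rcases x with B | m
          · exact hx.2.ssubset_of_ne fun h => hxA (by rw [h])
          · exact hx
        obtain ⟨h₁, h₂⟩ := hpar₃ x hsupp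
        have hcard := h₂ A hA hbelow
        have hm : ∃ m, m ∈ A ∧ m ∈ par x := by
          rcases x with B | m
          · obtain ⟨m, hm⟩ := hw.family.nonempty B hx.1
            exact ⟨m, hx.2 hm, h₁.1 hm⟩
          · exact ⟨m, hx, h₁⟩
        have hC : w (par x) ≠ 0 := by
          refine (hpar₁ x).resolve_left fun h => hrA ?_
          rw [h] at hcard
          rw [Finset.eq_univ_of_card A (le_antisymm (Finset.card_le_univ A) hcard)]
          exact Finset.mem_univ r
        have hsub : par x ⊆ A := by
          obtain ⟨m, hm₁, hm₂⟩ := hm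
          rcases hw.family.compat _ hC A hA with h | h | h | h
          · exact h
          · exact (Finset.eq_of_subset_of_card_le h hcard).symm.subset
          · exact absurd hm₁ (h m hm₂)
          · exact absurd (h r) (not_or.2 ⟨hw.family.root_notMem _ hC, hrA⟩)
        exact hy ⟨hC, hsub⟩
    · exfalso
      dsimp only at h
      subst h
      obtain ⟨hC, hCA⟩ : w (par y) ≠ 0 ∧ par y ⊆ A := hx
      have hsupp : ∀ B, y = .inl B → w B ≠ 0 := by
        intro B hB h
        rw [hpar₂ y B hB h] at hC
        exact hC hroot
      have h₁ := (hpar₃ y hsupp).1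
      apply hy
      rcases y with B | m
      · exact ⟨hsupp B rfl, h₁.1.trans hCA⟩
      · exact hCA h₁
  refine ⟨G, ω, ⟨hconn, ?_⟩, hω, ?_⟩
  · intro p q γ _
    refine (hw.le_dist p q).trans ?_
    have hsum : walkWeight ω γ =
        ∑ x, (γ.edges.map fun b => if e x = b then W x else 0).sum := sum_map_ite_eq e W _
    have hnn : ∀ x, ∀ c ∈ γ.edges.map (fun b => if e x = b then W x else 0), 0 ≤ c := by
      intro x c hc
      obtain ⟨b, -, rfl⟩ := List.mem_map.1 hc
      split_ifs <;> [exact hW x; exact le_rfl]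
    rw [hsum, Fintype.sum_sum_type]
    refine le_trans ?_ (le_add_of_nonneg_right (Finset.sum_nonneg fun m _ =>
      List.sum_nonneg (hnn _)))
    refine Finset.sum_le_sum fun A _ => ?_
    by_cases hA : w A = 0
    · rw [hA, zero_mul]
      exact List.sum_nonneg (hnn _)
    · have hkey : e (.inl A) ∈ γ.edges → w A * sep A p q ≤
          (γ.edges.map fun b => if e (.inl A) = b then W (.inl A) else 0).sum := by
        intro hmem
        have h₁ : w A ≤ (γ.edges.map fun b => if e (.inl A) = b then W (.inl A) else 0).sum := by
          refine List.single_le_sum (hnn _) _ (List.mem_map.2 ⟨_, hmem, ?_⟩)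
          simp [W]
        refine le_trans ?_ h₁
        unfold sep
        split_ifs
        · simpa using h0 A
        · simp
      by_cases hp : p ∈ A <;> by_cases hq : q ∈ A
      · simp only [sep, hp, hq, if_true, mul_zero]
        exact List.sum_nonneg (hnn _)
      · exact hkey (hcross A hA p hp q hq γ)
      · refine hkey ?_
        have := hcross A hA q hq p hp γ.reverse
        rwa [SimpleGraph.Walk.edges_reverse, List.mem_reverse] at this
      · simp only [sep, hp, hq, if_true, mul_zero]
        exact List.sum_nonneg (hnn _)
  · unfold graphWeight
    rw [finsum_mem_eq_finite_toFinset_sum _ (Set.toFinite _)]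
    calc ∑ b ∈ (Set.toFinite G.edgeSet).toFinset, ω b ≤ ∑ b, ω b :=
          Finset.sum_le_sum_of_subset_of_nonneg (Finset.subset_univ _) fun b _ _ => hω b
      _ = ∑ x, W x := by
          simp only [ω]
          rw [Finset.sum_comm]
          simp
      _ = splitWeight w := by simp [W, Fintype.sum_sum_type, splitWeight]

end Realize

section Trees

variable {X : Type*} {G : SimpleGraph X}

/-- In a tree, the edges of a path are those whose removal separates its endpoints. -/
lemma mem_edges_iff_not_reachable (hG : G.IsAcyclic) {x y : X} {γ : G.Walk x y}
    (hγ : γ.IsPath) (e : Sym2 X) :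
    e ∈ γ.edges ↔ ¬ (G.deleteEdges {e}).Reachable x y := by
  classical
  constructor
  · rintro he ⟨p⟩
    let p' : (G.deleteEdges {e}).Walk x y := p.bypass
    let q : G.Walk x y := p'.mapLe (SimpleGraph.deleteEdges_le _)
    have hq : q.IsPath := p.bypass_isPath.mapLe _
    have := congrArg Subtype.val ((hG.subsingleton_path x y).elim ⟨γ, hγ⟩ ⟨q, hq⟩)
    have hmem : e ∈ p'.edges := by
      rw [← SimpleGraph.Walk.edges_mapLe_eq_edges (SimpleGraph.deleteEdges_le _)]
      change γ = q at this
      change e ∈ q.edges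
      exact this ▸ he
    have := p'.edges_subset_edgeSet hmem
    simp [SimpleGraph.edgeSet_deleteEdges] at this
  · intro h
    by_contra he
    exact h ⟨γ.toDeleteEdge e he⟩

/-- Removing an edge of a connected graph leaves at most two components. -/
lemma reachable_or_of_not_reachable (hG : G.Connected) {e : Sym2 X} {x y z : X}
    (hx : ¬ (G.deleteEdges {e}).Reachable x y) (hz : ¬ (G.deleteEdges {e}).Reachable x z) :
    (G.deleteEdges {e}).Reachable y z := by
  induction e with
  | h a b =>
  have key : ∀ {v t : X}, G.Walk v t →
      (G.deleteEdges {s(a, b)}).Reachable t a ∨ (G.deleteEdges {s(a, b)}).Reachable t b →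
      (G.deleteEdges {s(a, b)}).Reachable v a ∨ (G.deleteEdges {s(a, b)}).Reachable v b := by
    intro v t γ ht
    induction γ with
    | nil => exact ht
    | @cons u v c h p ih =>
      by_cases he : s(u, v) = s(a, b)
      · rcases Sym2.eq_iff.1 he with ⟨rfl, -⟩ | ⟨rfl, -⟩
        · exact Or.inl (SimpleGraph.Reachable.refl _)
        · exact Or.inr (SimpleGraph.Reachable.refl _)
      · have hadj : (G.deleteEdges {s(a, b)}).Adj u v := by
          rw [SimpleGraph.deleteEdges_adj]
          exact ⟨h, he⟩
        exact (ih ht).imp hadj.reachable.trans hadj.reachable.trans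
  have key : ∀ v, (G.deleteEdges {s(a, b)}).Reachable v a ∨
      (G.deleteEdges {s(a, b)}).Reachable v b := fun v =>
    key (hG.preconnected v a).some (Or.inl (SimpleGraph.Reachable.refl _))
  rcases key x with h₁ | h₁ <;> rcases key y with h₂ | h₂ <;> rcases key z with h₃ | h₃
  · exact absurd (h₁.trans h₂.symm) hx
  · exact absurd (h₁.trans h₂.symm) hx
  · exact absurd (h₁.trans h₃.symm) hz
  · exact h₂.trans h₃.symm
  · exact h₂.trans h₃.symm
  · exact absurd (h₁.trans h₃.symm) hz
  · exact absurd (h₁.trans h₂.symm) hx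
  · exact absurd (h₁.trans h₂.symm) hx

/-- A component of the complement of `e` missing the edge `f` stays connected after
removing `f` instead. -/
lemma reachable_deleteEdges_of_not_reachable {e : Sym2 X} {u v x y : X}
    (hxy : (G.deleteEdges {e}).Reachable x y) (hx : ¬ (G.deleteEdges {e}).Reachable x u) :
    (G.deleteEdges {s(u, v)}).Reachable x y := by
  classical
  obtain ⟨p⟩ := hxy
  refine ⟨p.transfer _ fun f hf => ?_⟩
  rw [SimpleGraph.edgeSet_deleteEdges]
  have hfe := p.edges_subset_edgeSet hf
  rw [SimpleGraph.edgeSet_deleteEdges] at hfe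
  refine ⟨hfe.1, ?_⟩
  rintro rfl
  exact hx ⟨p.takeUntil u (p.fst_mem_support_of_mem_edges hf)⟩

/-- In a tree whose leaves are boundary, a path from `x` extends to one ending at a boundary
vertex. -/
lemma exists_path_to_boundary [Fintype X] {M : Type*} {ι : M ↪ X} (hG : GoodType G ι) {x : X}
    {e : Sym2 X} (n : ℕ) : ∀ (v : X) (γ : G.Walk x v), γ.IsPath → e ∈ γ.edges →
      Fintype.card X - γ.length = n → ∃ (m : M) (γ' : G.Walk x (ι m)), γ'.IsPath ∧
        e ∈ γ'.edges := by
  induction n using Nat.strong_induction_on with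
  | _ n ih =>
    intro v γ hγ he hn
    by_cases h : ∃ z, G.Adj v z ∧ z ∉ γ.support
    · obtain ⟨z, hz, hzγ⟩ := h
      have hlt := (hγ.concat hzγ hz).length_lt
      rw [SimpleGraph.Walk.length_concat] at hlt
      refine ih _ ?_ z (γ.concat hz) (hγ.concat hzγ hz) ?_ rfl
      · rw [SimpleGraph.Walk.length_concat]; omega
      · rw [SimpleGraph.Walk.edges_concat]
        simp [he]
    · push Not at h
      have hnil : ¬ γ.Nil := by
        intro hnil
        rw [SimpleGraph.Walk.edges_eq_nil.2 hnil] at he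
        simp at he
      have hdeg : deg G v = 1 := by
        unfold deg
        rw [Set.ncard_eq_one]
        refine ⟨γ.penultimate, ?_⟩
        ext z
        rw [SimpleGraph.mem_neighborSet, Set.mem_singleton_iff]
        constructor
        · intro hz
          exact hG.1.isAcyclic.eq_penultimate_of_adj_end hγ hz (h z hz)
        · rintro rfl
          exact (γ.adj_penultimate hnil).symm
      obtain ⟨m, rfl⟩ := hG.2 v hdeg
      exact ⟨m, γ, hγ, he⟩

/-- A tree with boundary leaves defines a split system with the same weight and distances. -/
theorem exists_split_of_tree [Fintype X] {M : Type*} [Fintype M] [DecidableEq M] (r : M)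
    {ι : M ↪ X} (hG : GoodType G ι) {w : Sym2 X → ℝ} {ρ : M → M → ℝ}
    (hw : IsGenFillingE G ι w ρ) :
    ∃ w' : Finset M → ℝ, IsSplitFilling r ρ w' ∧ splitWeight w' = graphWeight G w := by
  classical
  have hacyc := hG.1.isAcyclic
  have hconn := hw.1
  let A : Sym2 X → Finset M := fun e => Finset.univ.filter fun m =>
    ¬ (G.deleteEdges {e}).Reachable (ι r) (ι m)
  have hA : ∀ e m, m ∈ A e ↔ ¬ (G.deleteEdges {e}).Reachable (ι r) (ι m) := by simp [A]
  have hsep : ∀ e p q, sep (A e) p q =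
      if (G.deleteEdges {e}).Reachable (ι p) (ι q) then 0 else 1 := by
    intro e p q
    have : (p ∈ A e ↔ q ∈ A e) ↔ (G.deleteEdges {e}).Reachable (ι p) (ι q) := by
      rw [hA, hA, not_iff_not]
      constructor
      · intro h
        by_cases hp : (G.deleteEdges {e}).Reachable (ι r) (ι p)
        · exact hp.symm.trans (h.1 hp)
        · exact reachable_or_of_not_reachable hconn hp fun hq => hp (h.2 hq)
      · exact fun h => ⟨fun h' => h'.trans h, fun h' => h'.trans h.symm⟩
    unfold sep
    simp only [this]
  have hcompat : ∀ e ∈ G.edgeSet, ∀ f ∈ G.edgeSet, Compat (A e) (A f) := by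
    intro e he f hf
    rcases eq_or_ne e f with rfl | hne
    · exact compat_self _
    induction f with
    | h u v =>
    have hconst : ∀ p q, (G.deleteEdges {e}).Reachable (ι p) (ι q) →
        ¬ (G.deleteEdges {e}).Reachable (ι p) u → (p ∈ A s(u, v) ↔ q ∈ A s(u, v)) := by
      intro p q hpq hp
      have := reachable_deleteEdges_of_not_reachable (v := v) hpq hp
      rw [hA, hA, not_iff_not]
      exact ⟨fun h' => h'.trans this, fun h' => h'.trans this.symm⟩
    by_cases hr : (G.deleteEdges {e}).Reachable (ι r) u
    · have hin : ∀ p ∈ A e, ¬ (G.deleteEdges {e}).Reachable (ι p) u := by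
        intro p hp h
        exact (hA e p).1 hp (hr.trans h.symm)
      by_cases hex : ∃ p ∈ A e, p ∈ A s(u, v)
      · obtain ⟨p, hp, hpf⟩ := hex
        refine Or.inl fun q hq => ?_
        refine (hconst p q ?_ (hin p hp)).1 hpf
        exact reachable_or_of_not_reachable hconn ((hA e p).1 hp) ((hA e q).1 hq)
      · exact Or.inr (Or.inr (Or.inl fun p hp hpf => hex ⟨p, hp, hpf⟩))
    · refine Or.inr (Or.inl fun p hp => ?_)
      by_contra hpe
      have hrp : (G.deleteEdges {e}).Reachable (ι r) (ι p) := by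
        by_contra h
        exact hpe ((hA e p).2 h)
      have := (hconst r p hrp hr).2 hp
      rw [hA] at this
      exact this (SimpleGraph.Reachable.refl _)
  have hnonempty : ∀ e ∈ G.edgeSet, (A e).Nonempty := by
    intro e he
    obtain ⟨y, hy⟩ : ∃ y, ¬ (G.deleteEdges {e}).Reachable (ι r) y := by
      by_contra! hcon
      have hb := SimpleGraph.isAcyclic_iff_forall_isBridge.1 hacyc he
      induction e with
      | h u v =>
      rw [SimpleGraph.isBridge_iff] at hb
      exact hb ((hcon u).symm.trans (hcon v))
    obtain ⟨γ, hγ⟩ := hconn.exists_isPath (ι r) y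
    obtain ⟨m, γ', hγ', he'⟩ := exists_path_to_boundary hG _ y γ hγ
      ((mem_edges_iff_not_reachable hacyc hγ e).2 hy) rfl
    exact ⟨m, (hA e m).2 ((mem_edges_iff_not_reachable hacyc hγ' e).1 he')⟩
  let w' : Finset M → ℝ := fun T => ∑ e ∈ G.edgeFinset, if A e = T then w e else 0
  have hsupp : ∀ T, w' T ≠ 0 → ∃ e ∈ G.edgeSet, A e = T := by
    intro T hT
    obtain ⟨e, he, hne⟩ := Finset.exists_ne_zero_of_sum_ne_zero hT
    refine ⟨e, by simpa using he, ?_⟩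
    by_contra h
    exact hne (if_neg h)
  refine ⟨w', ⟨⟨?_, ?_, ?_⟩, ?_⟩, ?_⟩
  · intro S hS T hT
    obtain ⟨e, he, rfl⟩ := hsupp S hS
    obtain ⟨f, hf, rfl⟩ := hsupp T hT
    exact hcompat e he f hf
  · intro S hS
    obtain ⟨e, he, rfl⟩ := hsupp S hS
    rw [hA, not_not]
  · intro S hS
    obtain ⟨e, he, rfl⟩ := hsupp S hS
    exact hnonempty e he
  · intro p q
    obtain ⟨γ, hγ⟩ := hconn.exists_isPath (ι p) (ι q)
    refine (hw.2 p q γ hγ).trans_eq ?_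
    have h₁ : walkWeight w γ = ∑ e ∈ γ.edges.toFinset, w e :=
      (List.sum_toFinset w hγ.isTrail.edges_nodup).symm
    have h₂ : splitDist w' p q = ∑ e ∈ G.edgeFinset, w e * sep (A e) p q := by
      simp only [splitDist, w', Finset.sum_mul]
      rw [Finset.sum_comm]
      simp [ite_mul]
    rw [h₁, h₂]
    have h₃ : ∀ e, w e * sep (A e) p q = if e ∈ γ.edges.toFinset then w e else 0 := by
      intro e
      rw [hsep]
      simp only [List.mem_toFinset]
      have := mem_edges_iff_not_reachable hacyc hγ e
      by_cases h : e ∈ γ.edges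
      · rw [if_pos h, if_neg (this.1 h), mul_one]
      · rw [if_neg h, if_pos (not_not.1 (mt this.2 h)), mul_zero]
    rw [Finset.sum_congr rfl fun e _ => h₃ e, ← Finset.sum_filter]
    congr 1
    ext e
    simp only [List.mem_toFinset, Finset.mem_filter, SimpleGraph.mem_edgeFinset]
    exact ⟨fun h => ⟨γ.edges_subset_edgeSet h, h⟩, fun h => h.2⟩
  · unfold graphWeight splitWeight
    rw [finsum_mem_eq_finite_toFinset_sum _ (Set.toFinite _)]
    simp only [w']
    rw [Finset.sum_comm]
    simp only [Finset.sum_ite_eq, Finset.mem_univ, if_true]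
    refine Finset.sum_congr ?_ fun _ _ => rfl
    ext e
    simp

end Trees

section Pruning

variable {M X Y : Type*} {G : SimpleGraph X} {H : SimpleGraph Y} {ρ : M → M → ℝ}

/-- A connected graph mapping injectively into a generalized filling, compatibly with the
boundary, is again a generalized filling. -/
lemma IsGenFillingE.comap {ι : M ↪ X} {κ : M ↪ Y} {w : Sym2 X → ℝ}
    (hw : IsGenFillingE G ι w ρ) (φ : H →g G) (hφ : Function.Injective φ)
    (hH : H.Connected) (hι : ∀ m, φ (κ m) = ι m) :
    IsGenFillingE H κ (fun e => w (e.map φ)) ρ := by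
  refine ⟨hH, fun p q γ hγ => ?_⟩
  have := hw.2 p q ((γ.map φ).copy (hι p) (hι q))
    (by simpa using SimpleGraph.Walk.IsPath.map hφ hγ)
  simpa [walkWeight, Function.comp_def] using this

lemma graphWeight_comap_le [Finite X] {w : Sym2 X → ℝ} (h0 : ∀ e ∈ G.edgeSet, 0 ≤ w e)
    (φ : H →g G) (hφ : Function.Injective φ) :
    graphWeight H (fun e => w (e.map φ)) ≤ graphWeight G w := by
  have hinj : Function.Injective (Sym2.map φ) := Sym2.map.injective hφ
  have hsub : Sym2.map φ '' H.edgeSet ⊆ G.edgeSet := by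
    rintro _ ⟨e, he, rfl⟩
    exact φ.map_mem_edgeSet he
  unfold graphWeight
  rw [← finsum_mem_image (f := w) hinj.injOn,
    finsum_mem_eq_finite_toFinset_sum _ (Set.toFinite _),
    finsum_mem_eq_finite_toFinset_sum _ (Set.toFinite _)]
  refine Finset.sum_le_sum_of_subset_of_nonneg (by simpa using hsub) fun e he _ => ?_
  exact h0 e (by simpa using he)

/-- A nonnegative filling whose type is a tree can be pruned to one of good type. -/
lemma exists_good_of_isTree (n : ℕ) : ∀ {X : Type} [Fintype X] {G : SimpleGraph X} {ι : M ↪ X}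
    {w : Sym2 X → ℝ}, Fintype.card X = n → G.IsTree → IsGenFillingE G ι w ρ →
    (∀ e ∈ G.edgeSet, 0 ≤ w e) →
    ∃ (Y : Type) (_ : Fintype Y) (H : SimpleGraph Y) (κ : M ↪ Y) (w' : Sym2 Y → ℝ),
      IsGenFillingE H κ w' ρ ∧ GoodType H κ ∧ graphWeight H w' ≤ graphWeight G w := by
  classical
  induction n with
  | zero =>
    intro X _ G ι w hX hG
    have := hG.connected.nonempty
    exact absurd hX Fintype.card_ne_zero
  | succ n ih =>
    intro X _ G ι w hX hG hw h0
    by_cases hgood : GoodType G ι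
    · exact ⟨X, inferInstance, G, ι, w, hw, hgood, le_rfl⟩
    obtain ⟨v, hv, hvι⟩ : ∃ v, deg G v = 1 ∧ v ∉ Set.range ι := by
      simpa [GoodType, hG] using hgood
    have hdeg : G.degree v = 1 := by
      rw [← hv, deg, Set.ncard_eq_toFinset_card', ← SimpleGraph.card_neighborFinset_eq_degree]
      rfl
    let H := G.induce ({v}ᶜ : Set X)
    let φ : H →g G := (SimpleGraph.Embedding.induce ({v}ᶜ : Set X)).toHom
    have hφ : Function.Injective φ := Subtype.val_injective
    let κ : M ↪ ({v}ᶜ : Set X) :=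
      ⟨fun m => ⟨ι m, fun h => hvι ⟨m, h⟩⟩, fun a b h => ι.injective (congrArg Subtype.val h)⟩
    have hH : H.Connected := hG.connected.induce_compl_singleton_of_degree_eq_one hdeg
    obtain ⟨Y, hY, K, κ', w', h₁, h₂, h₃⟩ := ih (X := ({v}ᶜ : Set X)) (G := H) (ι := κ)
      (w := fun e => w (e.map φ)) (by rw [Fintype.card_compl_set]; simp [hX])
      ⟨hH, hG.isAcyclic.induce _⟩ (hw.comap φ hφ hH fun _ => rfl)
      (fun e he => h0 _ (φ.map_mem_edgeSet he))
    exact ⟨Y, hY, K, κ', w', h₁, h₂, h₃.trans (graphWeight_comap_le h0 φ hφ)⟩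

/-- Every filling dominates a generalized filling of good type. -/
theorem exists_good_of_nonneg {X : Type} [Fintype X] {G : SimpleGraph X} {ι : M ↪ X}
    {w : Sym2 X → ℝ} (hw : IsGenFillingE G ι w ρ) (h0 : ∀ e ∈ G.edgeSet, 0 ≤ w e) :
    ∃ (Y : Type) (_ : Fintype Y) (H : SimpleGraph Y) (κ : M ↪ Y) (w' : Sym2 Y → ℝ),
      IsGenFillingE H κ w' ρ ∧ GoodType H κ ∧ graphWeight H w' ≤ graphWeight G w := by
  obtain ⟨T, hT, hTree⟩ := hw.1.exists_isTree_le
  let φ : T →g G := SimpleGraph.Hom.ofLE hT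
  have hφ : Function.Injective φ := Function.injective_id
  obtain ⟨Y, hY, K, κ', w', h₁, h₂, h₃⟩ := exists_good_of_isTree _ rfl hTree
    (hw.comap φ hφ hTree.connected fun _ => rfl) (fun e he => h0 _ (φ.map_mem_edgeSet he))
  exact ⟨Y, hY, K, κ', w', h₁, h₂, h₃.trans (graphWeight_comap_le h0 φ hφ)⟩

/-- Without boundary, a tree of good type is a single vertex, hence has weight zero. -/
lemma graphWeight_eq_zero_of_isEmpty [IsEmpty M] [Fintype X] {ι : M ↪ X} (hG : GoodType G ι)
    (w : Sym2 X → ℝ) : graphWeight G w = 0 := by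
  classical
  have hX : Subsingleton X := by
    by_contra h
    rw [not_subsingleton_iff_nontrivial] at h
    obtain ⟨v, hv⟩ := hG.1.exists_vert_degree_one_of_nontrivial
    obtain ⟨m, -⟩ := hG.2 v (by
      rw [← hv, deg, Set.ncard_eq_toFinset_card', ← SimpleGraph.card_neighborFinset_eq_degree]
      rfl)
    exact isEmptyElim m
  have : G = ⊥ := Subsingleton.elim _ _
  simp [graphWeight, this]

end Pruning

/-- For a finite pseudometric space `(M, ρ)`,
`mf₋(M) = mf(M)`; equivalently, there exists a filling with nonnegative weight
function whose total weight equals `mf₋(M)`. -/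
theorem mfNeg_eq_mf (M : Type) [Fintype M] (ρ : M → M → ℝ) (hρ : IsPseudometric ρ) :
    mfNeg M ρ = mf M ρ ∧
      ∃ (V : Type) (_ : Fintype V) (G : SimpleGraph V) (ι : M ↪ V) (w : Sym2 V → ℝ),
        IsGenFillingE G ι w ρ ∧ (∀ e ∈ G.edgeSet, 0 ≤ w e) ∧
          graphWeight G w = mfNeg M ρ := by
  classical
  obtain ⟨W, hlow, X, hX, G, ι, w, hw, h0, hle⟩ : ∃ W : ℝ,
      (∀ (X : Type) (_ : Fintype X) (G : SimpleGraph X) (ι : M ↪ X) (w : Sym2 X → ℝ),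
        IsGenFillingE G ι w ρ → GoodType G ι → W ≤ graphWeight G w) ∧
      ∃ (X : Type) (_ : Fintype X) (G : SimpleGraph X) (ι : M ↪ X) (w : Sym2 X → ℝ),
        IsGenFillingE G ι w ρ ∧ (∀ e ∈ G.edgeSet, 0 ≤ w e) ∧ graphWeight G w ≤ W := by
    rcases isEmpty_or_nonempty M with hM | ⟨⟨r⟩⟩
    · refine ⟨0, fun X _ G ι w _ hG => (graphWeight_eq_zero_of_isEmpty hG w).ge, Unit,
        inferInstance, ⊥, ⟨isEmptyElim, fun a => isEmptyElim a⟩, 0,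
        ⟨.of_subsingleton, fun p => isEmptyElim p⟩, by simp, by simp [graphWeight]⟩
    · obtain ⟨s, hs, hs0, hopt⟩ := exists_nonneg_optimal r hρ
      obtain ⟨G, w, hw, h0, hle⟩ := exists_filling_of_split hs hs0
      refine ⟨splitWeight s, fun X _ G ι w hw hG => ?_, _, inferInstance, G, _, w, hw,
        fun e _ => h0 e, hle⟩
      obtain ⟨s', hs', heq⟩ := exists_split_of_tree r hG hw
      exact heq ▸ hopt s' hs'
  obtain ⟨Y, hY, H, κ, w', hw', hgood, hle'⟩ := exists_good_of_nonneg hw h0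
  have hH : graphWeight H w' = W := le_antisymm (hle'.trans hle) (hlow _ ‹_› _ _ _ hw' hgood)
  have hG : graphWeight G w = W := le_antisymm hle (hH ▸ hle')
  have hneg : mfNeg M ρ = W := by
    refine IsLeast.csInf_eq ⟨⟨Y, hY, H, κ, w', hw', hgood, hH.symm⟩, ?_⟩
    rintro _ ⟨X, hX, G, ι, w, hw, hG, rfl⟩
    exact hlow _ ‹_› _ _ _ hw hG
  have hmf : mf M ρ = W := by
    refine IsLeast.csInf_eq ⟨⟨X, hX, G, ι, w, hw, h0, hG.symm⟩, ?_⟩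
    rintro _ ⟨X, hX, G, ι, w, hw, h0, rfl⟩
    obtain ⟨Y, hY, H, κ, w', hw', hgood, hle'⟩ := exists_good_of_nonneg hw h0
    exact (hlow _ ‹_› _ _ _ hw' hgood).trans hle'
  exact ⟨hneg.trans hmf.symm, X, hX, G, ι, w, hw, h0, hG.trans hneg.symm⟩

end MinFill
end

section
/- Let 𝒢 = (G,w) be a generalized filling of a finite pseudometric space (M,ρ) whose type G = (V,E) is a tree, and let X,Y be adjacent interior vertices of degree 3 with w(XY) = −2e < 0. Let A,B be the neighbours of X other than Y and C,D the neighbours of Y other than X, with a = w(XA), b = w(XB), c = w(YC), d = w(YD). Define the modified tree G' = (V,E') with E' = (E ∖ {XB, YD}) ∪ {XD, YB} and the weight function w' given by w'(XY) = 2e, w'(XA) = a − e, w'(YB) = b − e, w'(YC) = c − e, w'(XD) = d − e, and w' = w on all other edges. Then: (i) for all u,v ∈ M, d_{w'}(u,v) ≥ d_w(u,v); (ii) w'(𝒢') = w(𝒢); consequently 𝒢' = (G',w') is a generalized filling of (M,ρ) of the same weight. -/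
open scoped BigOperators

namespace MinFill

variable {V : Type*}

open SimpleGraph

/-- In an acyclic graph, a path with adjacent endpoints is that edge. -/
lemma edges_eq_singleton_of_adj {G : SimpleGraph V} (hG : G.IsAcyclic) {u v : V}
    (h : G.Adj u v) {p : G.Walk u v} (hp : p.IsPath) : p.edges = [s(u, v)] := by
  have hq : h.toWalk.IsPath := by simp [h.ne]
  have := (hG.subsingleton_path u v).elim ⟨p, hp⟩ ⟨_, hq⟩
  rw [Subtype.mk.injEq] at this
  simp [this]

/-- In an acyclic graph, a path visiting both ends of an edge traverses it. -/
lemma mem_edges_of_adj {G : SimpleGraph V} (hG : G.IsAcyclic) {u v x y : V}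
    (h : G.Adj x y) {p : G.Walk u v} (hp : p.IsPath) (hx : x ∈ p.support) (hy : y ∈ p.support) :
    s(x, y) ∈ p.edges := by
  classical
  rw [← p.take_spec hx, Walk.mem_support_append_iff] at hy
  rcases hy with hy | hy
  · have := edges_eq_singleton_of_adj hG h.symm ((hp.takeUntil hx).dropUntil hy)
    refine p.edges_takeUntil_subset_edges hx (Walk.edges_dropUntil_subset_edges _ hy ?_)
    simp [this, Sym2.eq_swap]
  · have := edges_eq_singleton_of_adj hG h ((hp.dropUntil hx).takeUntil hy)
    refine p.edges_dropUntil_subset_edges hx (Walk.edges_takeUntil_subset_edges _ hy ?_)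
    simp [this]

/-- In an acyclic graph, every walk reduces to a path using exactly the edges which the walk
traverses an odd number of times. -/
lemma exists_isPath_count_mod_two [DecidableEq V] {G : SimpleGraph V} (hG : G.IsAcyclic) {u v : V}
    (p : G.Walk u v) :
    ∃ q : G.Walk u v, q.IsPath ∧ ∀ f, q.edges.count f % 2 = p.edges.count f % 2 := by
  induction p with
  | nil => exact ⟨.nil, .nil, fun _ => rfl⟩
  | @cons u v' v h p ih =>
    obtain ⟨q, hq, hc⟩ := ih
    by_cases hu : u ∈ q.support
    · refine ⟨q.dropUntil u hu, hq.dropUntil hu, fun f => ?_⟩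
      have ht := edges_eq_singleton_of_adj hG h.symm (hq.takeUntil hu)
      have := hc f
      rw [← q.take_spec hu, Walk.edges_append, ht, Sym2.eq_swap] at this
      simp only [List.singleton_append, List.count_cons, Walk.edges_cons] at this ⊢
      split_ifs at this ⊢ <;> lia
    · refine ⟨.cons h q, hq.cons hu, fun f => ?_⟩
      have := hc f
      simp only [List.count_cons, Walk.edges_cons]
      lia

/-- Replacing every edge of a walk by a walk with the same ends. -/
lemma exists_walk_edges_perm_flatMap {G G' : SimpleGraph V} (ψ : Sym2 V → List (Sym2 V))
    (h : ∀ a b, G'.Adj a b → ∃ r : G.Walk a b, r.edges.Perm (ψ s(a, b))) {u v : V}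
    (p : G'.Walk u v) : ∃ r : G.Walk u v, r.edges.Perm (p.edges.flatMap ψ) := by
  induction p with
  | nil => exact ⟨.nil, by simp⟩
  | cons hab p ih =>
    obtain ⟨r, hr⟩ := ih
    obtain ⟨t, ht⟩ := h _ _ hab
    exact ⟨t.append r, by simpa using ht.append hr⟩

/-- Connectedness transfers along a map of edges to reachable pairs. -/
lemma connected_of_adj_reachable {G G' : SimpleGraph V} (hG : G.Connected)
    (h : ∀ a b, G.Adj a b → G'.Reachable a b) : G'.Connected := by
  refine (connected_iff _).2 ⟨fun u v => ?_, hG.nonempty⟩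
  obtain ⟨p⟩ := hG.preconnected u v
  induction p with
  | nil => rfl
  | cons hab _ ih => exact (h _ _ hab).trans ih

/-- Three distinct neighbours of a vertex of degree three are all its neighbours. -/
lemma neighborSet_eq_of_deg_eq_three [Finite V] {G : SimpleGraph V} {x a b c : V}
    (hd : deg G x = 3) (ha : G.Adj x a) (hb : G.Adj x b) (hc : G.Adj x c)
    (hab : a ≠ b) (hac : a ≠ c) (hbc : b ≠ c) : G.neighborSet x = {a, b, c} := by
  refine (Set.eq_of_subset_of_ncard_le ?_ ?_ (Set.toFinite _)).symm
  · rintro _ (rfl | rfl | rfl) <;> assumption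
  · rw [← deg, hd, Set.ncard_eq_three.2 ⟨a, b, c, hab, hac, hbc, rfl⟩]

lemma countP_eq_count_add_count_add_count {α : Type*} [DecidableEq α] (P : α → Bool) {a b c : α}
    (hab : a ≠ b) (hac : a ≠ c) (hbc : b ≠ c) (l : List α)
    (h : ∀ f ∈ l, P f ↔ f = a ∨ f = b ∨ f = c) :
    l.countP P = l.count a + l.count b + l.count c := by
  induction l with
  | nil => simp
  | cons f l ih =>
    rw [List.forall_mem_cons] at h
    have := ih h.2
    have := h.1
    simp only [List.countP_cons, List.count_cons, beq_iff_eq]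
    grind

/-- A trail that neither starts nor ends at a vertex `x` with three neighbours uses an even number
of the edges at `x`. -/
lemma even_count_edges_of_neighborSet_eq [DecidableEq V] {G : SimpleGraph V} {x a b c u v : V}
    (hx : G.neighborSet x = {a, b, c}) (hab : a ≠ b) (hac : a ≠ c) (hbc : b ≠ c)
    {p : G.Walk u v} (hp : p.IsTrail) (hu : x ≠ u) (hv : x ≠ v) :
    Even (p.edges.count s(x, a) + p.edges.count s(x, b) + p.edges.count s(x, c)) := by
  have := (hp.even_countP_edges_iff x).2 fun _ => ⟨hu, hv⟩
  rwa [countP_eq_count_add_count_add_count _ (a := s(x, a)) (b := s(x, b)) (c := s(x, c))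
    (mt Sym2.congr_right.1 hab) (mt Sym2.congr_right.1 hac) (mt Sym2.congr_right.1 hbc)] at this
  intro f hf
  have hf := p.edges_subset_edgeSet hf
  induction f with | _ y z =>
  rw [mem_edgeSet] at hf
  have key : ∀ t, G.Adj x t ↔ t = a ∨ t = b ∨ t = c := fun t => by
    rw [← mem_neighborSet, hx]; simp
  simp only [Sym2.mem_iff, decide_eq_true_eq, Sym2.eq_iff]
  constructor
  · rintro (rfl | rfl)
    · simpa using Or.imp Or.inl (Or.imp Or.inl Or.inl) ((key _).1 hf)
    · simpa using Or.imp Or.inr (Or.imp Or.inr Or.inr) ((key _).1 hf.symm)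
  · rintro ((h | h) | (h | h) | (h | h)) <;> simp [h.1, h.2]

/-- The counts after replacing `p` by `m, x` and `q` by `m, y` in a list. -/
lemma count_flatMap_reroute {α : Type*} [DecidableEq α] {m x y p q : α}
    (h : [m, x, y, p, q].Nodup) (l : List α) (f : α) :
    (l.flatMap fun g => if g = p then [m, x] else if g = q then [m, y] else [g]).count f =
      if f = m then l.count m + l.count p + l.count q
      else if f = x then l.count x + l.count p
      else if f = y then l.count y + l.count q
      else if f = p ∨ f = q then 0 else l.count f := by
  induction l with
  | nil => simp
  | cons g l ih =>
    simp only [List.nodup_cons, List.mem_cons, List.not_mem_nil, or_false, not_or] at h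
    rw [List.flatMap_cons, List.count_append, ih]
    simp only [List.count_cons, beq_iff_eq]
    split_ifs <;> simp_all [List.count_cons] <;> grind

lemma sum_map_eq_sum_count {α : Type*} [Fintype α] [DecidableEq α] (l : List α) (w : α → ℝ) :
    (l.map w).sum = ∑ f, (l.count f : ℝ) * w f := by
  rw [Finset.sum_list_map_count]
  simp only [nsmul_eq_mul]
  refine Finset.sum_subset (Finset.subset_univ _) fun f _ hf => ?_
  rw [List.count_eq_zero_of_not_mem (by simpa using hf)]
  simp

/-- The weight comparison for rerouting `d'` through `m, d` and `b'` through `m, b`, in terms of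
edge counts only. -/
lemma sum_map_le_of_reroute {α : Type*} [Fintype α] [DecidableEq α] {m a b c d b' d' : α}
    (hnd : [m, a, b, c, d, b', d'].Nodup) {l l' : List α} (hl : l.Nodup) (hl' : l'.Nodup)
    {w w' : α → ℝ} {e : ℝ} (he : 0 < e) (hm : w m = -2 * e) (hm' : w' m = 2 * e)
    (ha : w' a = w a - e) (hb : w' b' = w b - e) (hc : w' c = w c - e) (hd : w' d' = w d - e)
    (hw : ∀ f ∈ l, f ∉ [m, a, b, c, d, b', d'] → w' f = w f) (hbl : b ∉ l) (hdl : d ∉ l)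
    (hX : Even (l.count m + l.count a + l.count d'))
    (hY : Even (l.count m + l.count b' + l.count c)) (hXY : a ∈ l → c ∈ l → m ∈ l)
    (hcount : ∀ f, l'.count f % 2 = (l.flatMap fun g =>
      if g = d' then [m, d] else if g = b' then [m, b] else [g]).count f % 2) :
    (l'.map w).sum ≤ (l.map w').sum := by
  have hnd' : [m, d, b, d', b'].Nodup := by
    simp only [List.nodup_cons, List.mem_cons, List.not_mem_nil, or_false, not_or] at hnd ⊢
    grind
  simp only [count_flatMap_reroute hnd'] at hcount
  rw [sum_map_eq_sum_count, sum_map_eq_sum_count, ← sub_nonneg, ← Finset.sum_sub_distrib]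
  rw [← Finset.sum_subset (Finset.subset_univ [m, a, b, c, d, b', d'].toFinset)]
  · have hle := List.nodup_iff_count_le_one.1 hl
    have hb0 := List.count_eq_zero_of_not_mem hbl
    have hd0 := List.count_eq_zero_of_not_mem hdl
    rw [← List.count_pos_iff, ← List.count_pos_iff, ← List.count_pos_iff] at hXY
    rw [List.sum_toFinset _ hnd]
    simp only [List.nodup_cons, List.mem_cons, List.not_mem_nil, or_false, not_or] at hnd
    have cm : l'.count m % 2 = (l.count m + l.count d' + l.count b') % 2 := by grind
    have ca : l'.count a = l.count a := by grind
    have cb : l'.count b = l.count b' := by grind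
    have cc : l'.count c = l.count c := by grind
    have cd : l'.count d = l.count d' := by grind
    have cb' : l'.count b' = 0 := by grind
    have cd' : l'.count d' = 0 := by grind
    have key : l.count a + l.count b' + l.count c + l.count d' ≤
        2 * l.count m + 2 * l'.count m := by
      have := hle m
      have := hle a
      have := hle b'
      have := hle c
      have := hle d'
      rw [Nat.even_iff] at hX hY
      lia
    have key : (l.count a + l.count b' + l.count c + l.count d' : ℝ) ≤
        2 * l.count m + 2 * l'.count m := mod_cast key
    simp only [List.map_cons, List.map_nil, List.sum_cons, List.sum_nil, ca, cb, cc, cd, cb', cd',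
      hb0, hd0, hm, hm', ha, hb, hc, hd, Nat.cast_zero]
    linear_combination e * key
  · intro f _ hf
    rw [List.mem_toFinset] at hf
    have h1 := List.nodup_iff_count_le_one.1 hl f
    have h2 := List.nodup_iff_count_le_one.1 hl' f
    have h3 := hcount f
    simp only [List.mem_cons, List.not_mem_nil, or_false, not_or] at hf
    simp only [hf, if_false, or_self] at h3
    have h4 : l'.count f = l.count f := by lia
    by_cases hfl : f ∈ l
    · rw [h4, hw f hfl (by simpa using hf)]; ring
    · rw [h4, List.count_eq_zero_of_not_mem hfl]; simp

/-- Comparing sums over two sets that differ by exchanging `b, d` for `b', d'`, when the summands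
agree outside the listed elements. -/
lemma finsum_mem_exchange {α N : Type*} [Finite α] [AddCommMonoid N] {m a b c d b' d' : α}
    (hnd : [m, a, b, c, d, b', d'].Nodup) {E E' : Set α} (hE : ∀ f ∈ [m, a, b, c, d], f ∈ E)
    (hb' : b' ∉ E) (hd' : d' ∉ E) (hE' : E' = (E \ {b, d}) ∪ {d', b'}) {w w' : α → N}
    (hw : ∀ f ∈ E', f ∉ [m, a, b, c, d, b', d'] → w' f = w f)
    (h : w' m + (w' a + (w' c + (w' b' + w' d'))) = w m + (w a + (w c + (w b + w d)))) :
    ∑ᶠ f ∈ E', w' f = ∑ᶠ f ∈ E, w f := by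
  classical
  simp only [List.nodup_cons, List.mem_cons, List.not_mem_nil, or_false, not_or] at hnd hE hw
  have hES : E = (E \ {m, a, c, b, d}) ∪ ([m, a, c, b, d].toFinset : Set α) := by
    ext f
    simp only [Set.mem_union, Set.mem_sdiff, Set.mem_insert_iff, Set.mem_singleton_iff,
      List.coe_toFinset, List.mem_cons, List.not_mem_nil, or_false, Set.mem_ofPred_eq]
    grind
  have hES' : E' = (E \ {m, a, c, b, d}) ∪ ([m, a, c, b', d'].toFinset : Set α) := by
    ext f
    simp only [hE', Set.mem_union, Set.mem_sdiff, Set.mem_insert_iff, Set.mem_singleton_iff,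
      List.coe_toFinset, List.mem_cons, List.not_mem_nil, or_false, Set.mem_ofPred_eq]
    grind
  have hd1 : Disjoint (E \ {m, a, c, b, d}) ([m, a, c, b, d].toFinset : Set α) := by
    rw [Set.disjoint_left]
    intro f
    simp
  have hd2 : Disjoint (E \ {m, a, c, b, d}) ([m, a, c, b', d'].toFinset : Set α) := by
    rw [Set.disjoint_left]
    intro f
    simp only [Set.mem_sdiff, Set.mem_insert_iff, Set.mem_singleton_iff, List.coe_toFinset,
      List.mem_cons, List.not_mem_nil, or_false, Set.mem_ofPred_eq]
    grind
  have hR : ∑ᶠ f ∈ E \ {m, a, c, b, d}, w' f = ∑ᶠ f ∈ E \ {m, a, c, b, d}, w f := by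
    refine finsum_mem_congr rfl fun f hf => ?_
    have hf' : f ∈ E' := hES' ▸ Or.inl hf
    simp only [Set.mem_sdiff, Set.mem_insert_iff, Set.mem_singleton_iff, not_or] at hf
    grind
  rw [hES', finsum_mem_union hd2 (Set.toFinite _) (Set.toFinite _), hR]
  conv_rhs => rw [hES, finsum_mem_union hd1 (Set.toFinite _) (Set.toFinite _)]
  rw [finsum_mem_coe_finset, finsum_mem_coe_finset, List.sum_toFinset _ (by grind),
    List.sum_toFinset _ (by grind)]
  simp [h]

/-- The modification of a generalized filling along a
negative-weight edge `XY` between interior vertices of degree 3 does not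
decrease distances between boundary points, preserves the total weight, and
hence yields a generalized filling of the same weight. -/
theorem modification_is_filling {V : Type*} [Fintype V] (G : SimpleGraph V)
    (hG : G.IsTree)
    (M : Set V) (ρ : V → V → ℝ) (hρ : IsPseudometricOn M ρ)
    (w : Sym2 V → ℝ) (hfill : IsGenFilling G w M ρ)
    (X Y A B C D : V) (e : ℝ) (he : 0 < e)
    (hXM : X ∉ M) (hYM : Y ∉ M) (hdX : deg G X = 3) (hdY : deg G Y = 3)
    (hXY : G.Adj X Y) (hXA : G.Adj X A) (hXB : G.Adj X B)
    (hYC : G.Adj Y C) (hYD : G.Adj Y D)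
    (hAB : A ≠ B) (hAY : A ≠ Y) (hBY : B ≠ Y)
    (hCD : C ≠ D) (hCX : C ≠ X) (hDX : D ≠ X)
    (hwXY : w s(X, Y) = -2 * e)
    (G' : SimpleGraph V)
    (hG' : G' = SimpleGraph.fromEdgeSet
      ((G.edgeSet \ {s(X, B), s(Y, D)}) ∪ {s(X, D), s(Y, B)}))
    (w' : Sym2 V → ℝ)
    (h1 : w' s(X, Y) = 2 * e) (h2 : w' s(X, A) = w s(X, A) - e)
    (h3 : w' s(Y, B) = w s(X, B) - e) (h4 : w' s(Y, C) = w s(Y, C) - e)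
    (h5 : w' s(X, D) = w s(Y, D) - e)
    (h6 : ∀ f ∈ G'.edgeSet,
      f ∉ ({s(X, Y), s(X, A), s(Y, B), s(Y, C), s(X, D)} : Set (Sym2 V)) →
        w' f = w f) :
    (∀ u ∈ M, ∀ v ∈ M, dw G w u v ≤ dw G' w' u v) ∧
      graphWeight G' w' = graphWeight G w ∧ IsGenFilling G' w' M ρ := by
  classical
  have tri : ∀ {x y z : V}, G.Adj x y → G.Adj y z → ¬ G.Adj x z := fun {x y z} hxy hyz hxz => by
    have hp : (Walk.cons hxy hyz.toWalk).IsPath := by simp [hxy.ne, hyz.ne, hxz.ne]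
    simpa using congrArg List.length (edges_eq_singleton_of_adj hG.isAcyclic hxz hp)
  have hAC : A ≠ C := fun h => tri hXY hYC (h ▸ hXA)
  have hAD : A ≠ D := fun h => tri hXY hYD (h ▸ hXA)
  have hBC : B ≠ C := fun h => tri hXY hYC (h ▸ hXB)
  have hBD : B ≠ D := fun h => tri hXY hYD (h ▸ hXB)
  have nXY := hXY.ne
  have nXA := hXA.ne
  have nXB := hXB.ne
  have nYC := hYC.ne
  have nYD := hYD.ne
  have hnd : [s(X, Y), s(X, A), s(X, B), s(Y, C), s(Y, D), s(Y, B), s(X, D)].Nodup := by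
    simp only [List.nodup_cons, List.mem_cons, List.not_mem_nil, or_false, not_or, Sym2.eq_iff]
    grind
  have hnXD : ¬ G.Adj X D := tri hXY hYD
  have hnYB : ¬ G.Adj Y B := tri hXY.symm hXB
  have nbX : G.neighborSet X = {Y, A, B} :=
    neighborSet_eq_of_deg_eq_three hdX hXY hXA hXB hAY.symm hBY.symm hAB
  have nbY : G.neighborSet Y = {X, C, D} :=
    neighborSet_eq_of_deg_eq_three hdY hXY.symm hYC hYD hCX.symm hDX.symm hCD
  have hE' : G'.edgeSet = (G.edgeSet \ {s(X, B), s(Y, D)}) ∪ {s(X, D), s(Y, B)} := by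
    rw [hG', edgeSet_fromEdgeSet, sdiff_eq_left, Set.disjoint_left]
    rintro f (⟨hf, -⟩ | rfl | rfl)
    · exact G.not_isDiag_of_mem_edgeSet hf
    · simpa using hDX.symm
    · simpa using hBY.symm
  have hadj : ∀ x y, G'.Adj x y ↔ G.Adj x y ∧ s(x, y) ≠ s(X, B) ∧ s(x, y) ≠ s(Y, D) ∨
      s(x, y) = s(X, D) ∨ s(x, y) = s(Y, B) := fun x y => by
    rw [← mem_edgeSet, hE']
    simp only [Set.mem_union, Set.mem_sdiff, Set.mem_insert_iff, Set.mem_singleton_iff, mem_edgeSet,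
      not_or, ne_eq]
  have hXY' : G'.Adj X Y := by grind
  have hXD' : G'.Adj X D := by grind
  have hYB' : G'.Adj Y B := by grind
  have nbX' : G'.neighborSet X = {Y, A, D} := by
    ext t
    have := Set.ext_iff.1 nbX t
    simp only [mem_neighborSet, Set.mem_insert_iff, Set.mem_singleton_iff, hadj, Sym2.eq_iff,
      ne_eq] at this ⊢
    grind only
  have nbY' : G'.neighborSet Y = {X, B, C} := by
    ext t
    have := Set.ext_iff.1 nbY t
    simp only [mem_neighborSet, Set.mem_insert_iff, Set.mem_singleton_iff, hadj, Sym2.eq_iff,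
      ne_eq] at this ⊢
    grind only
  have hE : ∀ f ∈ [s(X, Y), s(X, A), s(X, B), s(Y, C), s(Y, D)], f ∈ G.edgeSet := by
    simp [hXY, hXA, hXB, hYC, hYD]
  have hw : ∀ f ∈ G'.edgeSet,
      f ∉ [s(X, Y), s(X, A), s(X, B), s(Y, C), s(Y, D), s(Y, B), s(X, D)] → w' f = w f := by
    intro f hf hfn
    refine h6 f hf ?_
    simp only [List.mem_cons, List.not_mem_nil, or_false, not_or, Set.mem_insert_iff,
      Set.mem_singleton_iff] at hfn ⊢
    tauto
  have hconn : G'.Connected := by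
    refine connected_of_adj_reachable hG.connected fun a b hab => ?_
    by_cases h : G'.Adj a b
    · exact h.reachable
    · have : s(a, b) = s(X, B) ∨ s(a, b) = s(Y, D) := by grind
      have rXB : G'.Reachable X B := hXY'.reachable.trans hYB'.reachable
      have rYD : G'.Reachable Y D := hXY'.symm.reachable.trans hXD'.reachable
      rcases this with h | h <;> rcases Sym2.eq_iff.1 h with ⟨rfl, rfl⟩ | ⟨rfl, rfl⟩
      exacts [rXB, rXB.symm, rYD, rYD.symm]
  have hcard : G'.edgeSet.ncard = G.edgeSet.ncard := by
    rw [← finsum_one, ← finsum_one]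
    exact finsum_mem_exchange hnd hE hnYB hnXD hE' (fun _ _ _ => rfl) rfl
  have hG'tree : G'.IsTree := by
    rw [isTree_iff_connected_and_card]
    refine ⟨hconn, ?_⟩
    rw [Nat.card_coe_set_eq, hcard, ← Nat.card_coe_set_eq]
    exact (isTree_iff_connected_and_card.1 hG).2
  have hwalk : ∀ a b, G'.Adj a b → ∃ r : G.Walk a b, r.edges.Perm
      (if s(a, b) = s(X, D) then [s(X, Y), s(Y, D)]
        else if s(a, b) = s(Y, B) then [s(X, Y), s(X, B)] else [s(a, b)]) := by
    intro a b hab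
    split_ifs with hD hB
    · rcases Sym2.eq_iff.1 hD with ⟨rfl, rfl⟩ | ⟨rfl, rfl⟩
      · exact ⟨.cons hXY hYD.toWalk, by simp⟩
      · refine ⟨(Walk.cons hXY hYD.toWalk).reverse, ?_⟩
        rw [Walk.edges_reverse]
        exact (List.reverse_perm _).trans (by simp)
    · rcases Sym2.eq_iff.1 hB with ⟨rfl, rfl⟩ | ⟨rfl, rfl⟩
      · exact ⟨.cons hXY.symm hXB.toWalk, by simp [Sym2.eq_swap]⟩
      · refine ⟨(Walk.cons hXY.symm hXB.toWalk).reverse, ?_⟩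
        rw [Walk.edges_reverse]
        exact (List.reverse_perm _).trans (by simp [Sym2.eq_swap])
    · have : G.Adj a b := by
        have := (hadj a b).1 hab
        tauto
      exact ⟨this.toWalk, by simp⟩
  have hpath : ∀ u ∈ M, ∀ v ∈ M, ∀ p : G'.Walk u v, p.IsPath →
      ∃ q : G.Walk u v, q.IsPath ∧ walkWeight w q ≤ walkWeight w' p := by
    intro u hu v hv p hp
    obtain ⟨r, hr⟩ := exists_walk_edges_perm_flatMap (G := G) (fun g =>
      if g = s(X, D) then [s(X, Y), s(Y, D)] else if g = s(Y, B) then [s(X, Y), s(X, B)] else [g])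
      hwalk p
    obtain ⟨q, hq, hc⟩ := exists_isPath_count_mod_two hG.isAcyclic r
    have hnp : ∀ f ∈ p.edges, f ∈ G'.edgeSet := fun f hf => p.edges_subset_edgeSet hf
    refine ⟨q, hq, sum_map_le_of_reroute hnd hp.isTrail.edges_nodup hq.isTrail.edges_nodup he hwXY
      h1 h2 h3 h4 h5 (fun f hf => hw f (hnp f hf)) (fun h => ?_) (fun h => ?_) ?_ ?_
      (fun hA hC => ?_) fun f => by rw [hc, hr.count_eq]⟩
    · have := (hadj _ _).1 (hnp _ h)
      simp only [List.nodup_cons, List.mem_cons, not_or] at hnd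
      tauto
    · have := (hadj _ _).1 (hnp _ h)
      simp only [List.nodup_cons, List.mem_cons, not_or] at hnd
      tauto
    · exact even_count_edges_of_neighborSet_eq nbX' hAY.symm nYD hAD hp.isTrail
        (fun h => hXM (h ▸ hu)) (fun h => hXM (h ▸ hv))
    · rw [Sym2.eq_swap (a := X) (b := Y)]
      exact even_count_edges_of_neighborSet_eq nbY' nXB hCX.symm hBC hp.isTrail
        (fun h => hYM (h ▸ hu)) (fun h => hYM (h ▸ hv))
    · exact mem_edges_of_adj hG'tree.isAcyclic hXY' hp (p.fst_mem_support_of_mem_edges hA)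
        (p.fst_mem_support_of_mem_edges hC)
  refine ⟨fun u hu v hv => ?_, ?_, hconn, fun u hu v hv p hp => ?_⟩
  · obtain ⟨p, hp⟩ := hconn.exists_isPath u v
    refine le_csInf ⟨_, p, hp, rfl⟩ ?_
    rintro _ ⟨p, hp, rfl⟩
    obtain ⟨q, hq, hle⟩ := hpath u hu v hv p hp
    refine le_trans (csInf_le ⟨walkWeight w q, ?_⟩ ⟨q, hq, rfl⟩) hle
    rintro _ ⟨q', hq', rfl⟩
    have := (hG.isAcyclic.subsingleton_path u v).elim ⟨q, hq⟩ ⟨q', hq'⟩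
    rw [Subtype.mk.injEq] at this
    rw [this]
  · refine finsum_mem_exchange hnd hE hnYB hnXD hE' hw ?_
    rw [h1, h2, h3, h4, h5, hwXY]
    ring
  · obtain ⟨q, hq, hle⟩ := hpath u hu v hv p hp
    exact (hfill.2 u hu v hv q hq).trans hle

end MinFill
end
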